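/- arXiv:2209.11040 — 5 statements merged into one kernel-verified Lean document; each statement's English description precedes it below -/
import Mathlib

section
/- Let W ⊆ B⊗C be a linear subspace with R(W) = r, and let w ∈ W be nonzero. Then there exists a complementary subspace W̃ ⊂ W with W̃ ⊕ span(w) = W and R(W̃) ≤ r − 1. Moreover, if additionally w has matrix rank 1, then for every complementary subspace W̃ with W̃ ⊕ span(w) = W, one has R(W̃) ≥ r − 1. -/
open TensorProduct

/-- Rank of a subspace `W ⊆ B ⊗ C`: minimal number of rank-one matrices whose span
contains `W`. -/
noncomputable def sRank (k : Type*) [Field k] {B C : Type*} [AddCommGroup B] [Module k B]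
    [AddCommGroup C] [Module k C] (W : Submodule k (B ⊗[k] C)) : ℕ :=
  sInf {r | ∃ s : Fin r → B ⊗[k] C, (∀ i, ∃ b c, s i = b ⊗ₜ[k] c) ∧
    W ≤ Submodule.span k (Set.range s)}

theorem sRank_le_of_le_span {k : Type*} [Field k] {B C : Type*} [AddCommGroup B] [Module k B]
    [AddCommGroup C] [Module k C] {W : Submodule k (B ⊗[k] C)} {n : ℕ} (s : Fin n → B ⊗[k] C)
    (hs : ∀ i, ∃ b c, s i = b ⊗ₜ[k] c) (hW : W ≤ Submodule.span k (Set.range s)) :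
    sRank k W ≤ n :=
  Nat.sInf_le ⟨s, hs, hW⟩

theorem exists_le_span_of_sRank {k : Type*} [Field k] {B C : Type*}
    [AddCommGroup B] [Module k B] [FiniteDimensional k B]
    [AddCommGroup C] [Module k C] [FiniteDimensional k C] (W : Submodule k (B ⊗[k] C)) :
    ∃ s : Fin (sRank k W) → B ⊗[k] C, (∀ i, ∃ b c, s i = b ⊗ₜ[k] c) ∧
      W ≤ Submodule.span k (Set.range s) := by
  refine Nat.sInf_mem (s := {r | ∃ s : Fin r → B ⊗[k] C, (∀ i, ∃ b c, s i = b ⊗ₜ[k] c) ∧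
    W ≤ Submodule.span k (Set.range s)}) ?_
  obtain ⟨t, ht, hspan⟩ := (Submodule.fg_span_iff_fg_span_finset_subset
    (R := k) {x : B ⊗[k] C | ∃ b c, b ⊗ₜ[k] c = x}).1 (IsNoetherian.noetherian _)
  refine ⟨t.card, fun i => t.equivFin.symm i, fun i => ?_, ?_⟩
  · obtain ⟨b, c, h⟩ := ht (t.equivFin.symm i).2
    exact ⟨b, c, h.symm⟩
  · have hrange : Set.range (fun i => (t.equivFin.symm i : B ⊗[k] C)) = t := by
      rw [show (fun i => (t.equivFin.symm i : B ⊗[k] C)) = Subtype.val ∘ t.equivFin.symm from rfl,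
        EquivLike.range_comp]
      simp
    rw [hrange, ← hspan, TensorProduct.span_tmul_eq_top]
    exact le_top

/-- Exchange: a vector with nonzero `i`-th coefficient can replace the `i`-th generator. -/
theorem span_range_le_span_succAbove_sup {k M : Type*} [Field k] [AddCommGroup M] [Module k M]
    {n : ℕ} (s : Fin (n + 1) → M) (a : Fin (n + 1) → k) {i : Fin (n + 1)} (hi : a i ≠ 0) :
    Submodule.span k (Set.range s) ≤
      Submodule.span k (Set.range (s ∘ i.succAbove)) ⊔ Submodule.span k {∑ j, a j • s j} := by
  set V := Submodule.span k (Set.range (s ∘ i.succAbove)) with hV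
  have hmem : ∀ j, s (i.succAbove j) ∈ V := fun j => Submodule.subset_span ⟨j, rfl⟩
  rw [Submodule.span_le]
  rintro _ ⟨j, rfl⟩
  obtain rfl | ⟨j, rfl⟩ := Fin.eq_self_or_eq_succAbove i j
  · have hsum : a j • s j ∈ V ⊔ Submodule.span k {∑ j, a j • s j} := by
      rw [show a j • s j = -(∑ l, a (j.succAbove l) • s (j.succAbove l)) + ∑ l, a l • s l by
        rw [Fin.sum_univ_succAbove _ j]; abel]
      exact Submodule.add_mem_sup
        (V.neg_mem (Submodule.sum_mem _ fun l _ => V.smul_mem _ (hmem l)))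
        (Submodule.mem_span_singleton_self _)
    exact (Submodule.smul_mem_iff _ hi).1 hsum
  · exact Submodule.mem_sup_left (hmem j)

/-- Substitution method for spaces of matrices: for `W ⊆ B ⊗ C` with `R(W) = r` and
`0 ≠ w ∈ W`: (1) some complement `W̃` of `span(w)` in `W` has `R(W̃) ≤ r − 1`, and
(2) if moreover `w` has matrix rank one, every such complement has `R(W̃) ≥ r − 1`. -/
theorem substitution_for_subspaces {k : Type*} [Field k] {B C : Type*}
    [AddCommGroup B] [Module k B] [FiniteDimensional k B]
    [AddCommGroup C] [Module k C] [FiniteDimensional k C]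
    (W : Submodule k (B ⊗[k] C)) {r : ℕ} (hr : sRank k W = r)
    (w : B ⊗[k] C) (hw : w ∈ W) (hw0 : w ≠ 0) :
    (∃ W' : Submodule k (B ⊗[k] C), Disjoint W' (Submodule.span k {w}) ∧
        W' ⊔ Submodule.span k {w} = W ∧ sRank k W' ≤ r - 1) ∧
    ((∃ b c, w = b ⊗ₜ[k] c) →
      ∀ W' : Submodule k (B ⊗[k] C), Disjoint W' (Submodule.span k {w}) →
        W' ⊔ Submodule.span k {w} = W → r - 1 ≤ sRank k W') := by
  subst hr
  have hwW : Submodule.span k {w} ≤ W := (Submodule.span_singleton_le_iff_mem _ _).2 hw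
  constructor
  · obtain ⟨s, hs, hWs⟩ := exists_le_span_of_sRank W
    obtain ⟨a, ha⟩ := (Submodule.mem_span_range_iff_exists_fun k).1 (hWs hw)
    obtain ⟨i, hi⟩ : ∃ i, a i ≠ 0 := by
      by_contra! h
      exact hw0 (by simp [← ha, h])
    generalize hn : sRank k W = n at s a i
    obtain _ | n := n
    · exact i.elim0
    have hexch := hWs.trans (span_range_le_span_succAbove_sup s a hi)
    rw [ha] at hexch
    set V := Submodule.span k (Set.range (s ∘ i.succAbove))
    have hwV : w ∉ V := fun h => by
      have hWV : W ≤ V := hexch.trans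
        (sup_le le_rfl ((Submodule.span_singleton_le_iff_mem _ _).2 h))
      have := sRank_le_of_le_span _ (fun j => hs (i.succAbove j)) hWV
      omega
    refine ⟨W ⊓ V, ?_, ?_, sRank_le_of_le_span _ (fun j => hs (i.succAbove j)) inf_le_right⟩
    · exact ((Submodule.disjoint_span_singleton' hw0).2 hwV).mono_left inf_le_right
    · rw [inf_sup_assoc_of_le _ hwW]
      exact inf_eq_left.2 hexch
  · intro hw1 W' _ hsup
    obtain ⟨s, hs, hWs⟩ := exists_le_span_of_sRank W'
    have hle : sRank k W ≤ sRank k W' + 1 := by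
      refine sRank_le_of_le_span (Fin.cons w s : Fin (sRank k W' + 1) → B ⊗[k] C)
        (Fin.cases hw1 hs) ?_
      rw [Fin.range_cons, Submodule.span_insert, sup_comm, ← hsup]
      exact sup_le_sup_right hWs _
    omega
end

section
/- Let W = W'⊕W'' ⊆ (B'⊕B'')⊗(C'⊕C'') with W' ⊆ B'⊗C', W'' ⊆ B''⊗C'', and fix a minimal decomposition V of W with associated subspaces E', E'' ⊆ B and F', F'' ⊆ C. If R(W'⊕W'') < R(W') + R(W''), then e' < R(W') − dim W', f' < R(W') − dim W', e'' < R(W'') − dim W'', and f'' < R(W'') − dim W''. -/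
open TensorProduct

/-- The subspace `S ⊗ T ⊆ B ⊗ C` spanned by simple tensors with factors in the
submodules `S` and `T`. -/
noncomputable def tensorSub (k : Type*) [Field k] {B C : Type*} [AddCommGroup B] [Module k B]
    [AddCommGroup C] [Module k C] (S : Submodule k B) (T : Submodule k C) :
    Submodule k (B ⊗[k] C) :=
  Submodule.span k {x | ∃ b ∈ S, ∃ c ∈ T, x = b ⊗ₜ[k] c}

/-- `V` is a minimal decomposition of `W`: it contains `W`, has dimension `R(W)`, and is
spanned by the rank-one matrices it contains. -/
def IsMinDecomp (k : Type*) [Field k] {B C : Type*} [AddCommGroup B] [Module k B]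
    [AddCommGroup C] [Module k C] (W V : Submodule k (B ⊗[k] C)) : Prop :=
  W ≤ V ∧ Module.finrank k V = sRank k W ∧
    V = Submodule.span k {v | v ∈ V ∧ ∃ b c, v = b ⊗ₜ[k] c}

section Blocks

variable (k : Type*) [Field k] (B' B'' C' C'' : Type*)
  [AddCommGroup B'] [Module k B'] [AddCommGroup B''] [Module k B'']
  [AddCommGroup C'] [Module k C'] [AddCommGroup C''] [Module k C'']

/-- The inclusion `B' ⊗ C' → (B' ⊕ B'') ⊗ (C' ⊕ C'')`. -/
noncomputable def ιL : B' ⊗[k] C' →ₗ[k] (B' × B'') ⊗[k] (C' × C'') :=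
  TensorProduct.map (LinearMap.inl k B' B'') (LinearMap.inl k C' C'')

/-- The inclusion `B'' ⊗ C'' → (B' ⊕ B'') ⊗ (C' ⊕ C'')`. -/
noncomputable def ιR : B'' ⊗[k] C'' →ₗ[k] (B' × B'') ⊗[k] (C' × C'') :=
  TensorProduct.map (LinearMap.inr k B' B'') (LinearMap.inr k C' C'')

/-- The projection `π_{C''} : B ⊗ C → B ⊗ C'` with kernel `B ⊗ C''`. -/
noncomputable def projCbis : (B' × B'') ⊗[k] (C' × C'') →ₗ[k] (B' × B'') ⊗[k] C' :=
  TensorProduct.map LinearMap.id (LinearMap.fst k C' C'')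

/-- The projection `π_{C'} : B ⊗ C → B ⊗ C''` with kernel `B ⊗ C'`. -/
noncomputable def projCprim : (B' × B'') ⊗[k] (C' × C'') →ₗ[k] (B' × B'') ⊗[k] C'' :=
  TensorProduct.map LinearMap.id (LinearMap.snd k C' C'')

/-- The projection `π_{B''} : B ⊗ C → B' ⊗ C` with kernel `B'' ⊗ C`. -/
noncomputable def projBbis : (B' × B'') ⊗[k] (C' × C'') →ₗ[k] B' ⊗[k] (C' × C'') :=
  TensorProduct.map (LinearMap.fst k B' B'') LinearMap.id

/-- The projection `π_{B'} : B ⊗ C → B'' ⊗ C` with kernel `B' ⊗ C`. -/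
noncomputable def projBprim : (B' × B'') ⊗[k] (C' × C'') →ₗ[k] B'' ⊗[k] (C' × C'') :=
  TensorProduct.map (LinearMap.snd k B' B'') LinearMap.id

variable {k B' B'' C' C''}

/-- `E'' ⊆ B''` satisfies `π_{C''}(V) ⊆ (B' ⊕ E'') ⊗ C'`. -/
noncomputable def IsEbisBound (V : Submodule k ((B' × B'') ⊗[k] (C' × C'')))
    (E'' : Submodule k B'') : Prop :=
  V.map (projCbis k B' B'' C' C'') ≤
    tensorSub k (LinearMap.range (LinearMap.inl k B' B'') ⊔ E''.map (LinearMap.inr k B' B''))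
      (⊤ : Submodule k C')

/-- `E' ⊆ B'` satisfies `π_{C'}(V) ⊆ (E' ⊕ B'') ⊗ C''`. -/
noncomputable def IsEprimBound (V : Submodule k ((B' × B'') ⊗[k] (C' × C'')))
    (E' : Submodule k B') : Prop :=
  V.map (projCprim k B' B'' C' C'') ≤
    tensorSub k (E'.map (LinearMap.inl k B' B'') ⊔ LinearMap.range (LinearMap.inr k B' B''))
      (⊤ : Submodule k C'')

/-- `F'' ⊆ C''` satisfies `π_{B''}(V) ⊆ B' ⊗ (C' ⊕ F'')`. -/
noncomputable def IsFbisBound (V : Submodule k ((B' × B'') ⊗[k] (C' × C'')))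
    (F'' : Submodule k C'') : Prop :=
  V.map (projBbis k B' B'' C' C'') ≤
    tensorSub k (⊤ : Submodule k B')
      (LinearMap.range (LinearMap.inl k C' C'') ⊔ F''.map (LinearMap.inr k C' C''))

/-- `F' ⊆ C'` satisfies `π_{B'}(V) ⊆ B'' ⊗ (F' ⊕ C'')`. -/
noncomputable def IsFprimBound (V : Submodule k ((B' × B'') ⊗[k] (C' × C'')))
    (F' : Submodule k C') : Prop :=
  V.map (projBprim k B' B'' C' C'') ≤
    tensorSub k (⊤ : Submodule k B'')
      (F'.map (LinearMap.inl k C' C'') ⊔ LinearMap.range (LinearMap.inr k C' C''))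

end Blocks

section Auxiliary

open Module

variable {k : Type*} [Field k]

theorem finrank_map_add_finrank_le {M N : Type*} [AddCommGroup M] [Module k M]
    [AddCommGroup N] [Module k N] [FiniteDimensional k M] (f : M →ₗ[k] N)
    {U K : Submodule k M} (hKU : K ≤ U) (hK : K ≤ LinearMap.ker f) :
    finrank k (U.map f) + finrank k K ≤ finrank k U := by
  have h := LinearMap.finrank_range_add_finrank_ker (f.domRestrict U)
  rw [LinearMap.range_domRestrict] at h
  have hle : finrank k K ≤ finrank k (LinearMap.ker (f.domRestrict U)) := by
    refine LinearMap.finrank_le_finrank_of_injective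
      (f := (Submodule.inclusion hKU).codRestrict _ fun x => ?_) fun x y hxy => ?_
    · simpa using hK x.2
    · exact Submodule.inclusion_injective hKU (congrArg Subtype.val hxy)
  omega

theorem map_le_map_of_comp_eq {L M N : Type*} [AddCommGroup L] [Module k L]
    [AddCommGroup M] [Module k M] [AddCommGroup N] [Module k N] {f : M →ₗ[k] N}
    {g : L →ₗ[k] M} {e : L →ₗ[k] N} (h : f ∘ₗ g = e) {W : Submodule k L}
    {V : Submodule k M} (hW : W.map g ≤ V) : W.map e ≤ V.map f := by
  rw [← h, Submodule.map_comp]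
  exact Submodule.map_mono hW

theorem map_le_ker_of_comp_eq_zero {L M N : Type*} [AddCommGroup L] [Module k L]
    [AddCommGroup M] [Module k M] [AddCommGroup N] [Module k N] {f : M →ₗ[k] N}
    {g : L →ₗ[k] M} (h : f ∘ₗ g = 0) {W : Submodule k L} :
    W.map g ≤ LinearMap.ker f :=
  LinearMap.map_le_range.trans (LinearMap.range_le_ker_iff.2 h)

variable {P Q X Y : Type*} [AddCommGroup P] [Module k P] [AddCommGroup Q] [Module k Q]
  [AddCommGroup X] [Module k X] [AddCommGroup Y] [Module k Y]

/-- A subspace of a tensor product is spanned by the simple tensors it contains. -/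
def SpannedBySimple (U : Submodule k (P ⊗[k] Q)) : Prop :=
  U = Submodule.span k {v | v ∈ U ∧ ∃ b c, v = b ⊗ₜ[k] c}

theorem SpannedBySimple.map {U : Submodule k (P ⊗[k] Q)} (hU : SpannedBySimple U)
    (f : P ⊗[k] Q →ₗ[k] X ⊗[k] Y) (hf : ∀ b c, ∃ x y, f (b ⊗ₜ c) = x ⊗ₜ y) :
    SpannedBySimple (U.map f) := by
  refine le_antisymm ?_ (Submodule.span_le.2 fun v hv => hv.1)
  conv_lhs => rw [hU]
  rw [Submodule.map_span]
  refine Submodule.span_mono ?_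
  rintro _ ⟨v, ⟨hv, b, c, rfl⟩, rfl⟩
  exact ⟨Submodule.mem_map_of_mem hv, hf b c⟩

theorem sRank_le_finrank [FiniteDimensional k P] [FiniteDimensional k Q]
    {W U : Submodule k (P ⊗[k] Q)} (hU : SpannedBySimple U) (hWU : W ≤ U) :
    sRank k W ≤ finrank k U := by
  obtain ⟨s, hs, hspan, -⟩ := Submodule.exists_fun_fin_finrank_span_eq k
    {v | v ∈ U ∧ ∃ b c, v = b ⊗ₜ[k] c}
  have h : sRank k W ≤ finrank k (Submodule.span k {v | v ∈ U ∧ ∃ b c, v = b ⊗ₜ[k] c}) :=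
    Nat.sInf_le ⟨s, fun i => (hs i).2, by rw [hspan, ← hU]; exact hWU⟩
  rwa [← hU] at h

theorem linearIndependent_tmul_of_ne_zero {ι : Type*} {x : ι → X} {y : ι → Y}
    (hx : LinearIndependent k x) (hy : ∀ i, y i ≠ 0) :
    LinearIndependent k fun i => x i ⊗ₜ[k] y i := by
  classical
  rw [linearIndependent_iff']
  intro s a ha i hi
  obtain ⟨h, hh⟩ := LinearMap.exists_extend (p := Submodule.span k (Set.range x))
    (Finsupp.lapply i ∘ₗ hx.repr)
  have hxh (j : ι) : h (x j) = if j = i then 1 else 0 := by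
    have := LinearMap.congr_fun hh ⟨x j, Submodule.subset_span ⟨j, rfl⟩⟩
    rw [LinearMap.comp_apply, Submodule.subtype_apply, LinearMap.comp_apply,
      hx.repr_eq_single j _ rfl] at this
    rw [this, Finsupp.lapply_apply, Finsupp.single_apply]
  have := congrArg ((TensorProduct.lid k Y).toLinearMap ∘ₗ
    TensorProduct.map h LinearMap.id) ha
  simpa [hxh, hi, hy i] using this

/-- The span of the images under `p` of the left factors of the nonzero simple tensors
in `U`. -/
def leftSupport (p : P →ₗ[k] X) (U : Submodule k (P ⊗[k] Q)) : Submodule k X :=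
  Submodule.span k {x | ∃ b c, c ≠ 0 ∧ b ⊗ₜ[k] c ∈ U ∧ p b = x}

/-- Projecting away a basis of the left support bounds the rank of a complementary
block. -/
theorem sRank_add_finrank_leftSupport_le [FiniteDimensional k P] [FiniteDimensional k Q]
    [FiniteDimensional k X] [FiniteDimensional k Y]
    (p : P →ₗ[k] X) (q : P →ₗ[k] Y) (j : Y →ₗ[k] P)
    (hqj : q ∘ₗ j = LinearMap.id) (hpj : p ∘ₗ j = 0)
    {U : Submodule k (P ⊗[k] Q)} (hU : SpannedBySimple U)
    {W : Submodule k (Y ⊗[k] Q)} (hW : W.map (TensorProduct.map j LinearMap.id) ≤ U) :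
    sRank k W + finrank k (leftSupport p U) ≤ finrank k U := by
  obtain ⟨x, hx, -, hli⟩ := Submodule.exists_fun_fin_finrank_span_eq k
    {x | ∃ b c, c ≠ 0 ∧ b ⊗ₜ[k] c ∈ U ∧ p b = x}
  choose b c hc hbc hpb using hx
  obtain ⟨g, hg⟩ := LinearMap.exists_extend ((Basis.span hli).constr k fun i => -q (b i))
  have hgx (i) : g (x i) = -q (b i) := by
    have := LinearMap.congr_fun hg (Basis.span hli i)
    rw [Basis.constr_basis, LinearMap.comp_apply, Submodule.subtype_apply,
      Basis.span_apply] at this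
    exact this
  set φ : P →ₗ[k] Y := q + g ∘ₗ p with hφ
  have hφj : φ ∘ₗ j = LinearMap.id := by
    rw [hφ, LinearMap.add_comp, LinearMap.comp_assoc, hpj, LinearMap.comp_zero, add_zero, hqj]
  have hφb (i) : φ (b i) = 0 := by simp [hφ, hpb, hgx]
  set Φ : P ⊗[k] Q →ₗ[k] Y ⊗[k] Q := TensorProduct.map φ LinearMap.id with hΦ
  have hrank : sRank k W ≤ finrank k (U.map Φ) := by
    refine sRank_le_finrank (hU.map Φ fun b c => ⟨φ b, c, rfl⟩) ?_
    have := Submodule.map_mono (f := Φ) hW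
    rwa [← Submodule.map_comp, hΦ, ← TensorProduct.map_comp, hφj, LinearMap.id_comp,
      TensorProduct.map_id, Submodule.map_id] at this
  have hind : LinearIndependent k fun i => b i ⊗ₜ[k] c i := by
    refine LinearIndependent.of_comp (TensorProduct.map p LinearMap.id) ?_
    simpa [Function.comp_def, hpb] using linearIndependent_tmul_of_ne_zero hli hc
  have hdim := finrank_map_add_finrank_le Φ
    (U := U) (K := Submodule.span k (Set.range fun i => b i ⊗ₜ[k] c i))
    (Submodule.span_le.2 (by rintro _ ⟨i, rfl⟩; exact hbc i))
    (Submodule.span_le.2 (by rintro _ ⟨i, rfl⟩; simp [hΦ, hφb]))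
  rw [finrank_span_eq_card hind, Fintype.card_fin] at hdim
  exact (Nat.add_le_add_right hrank _).trans hdim

theorem le_tensorSub_of_leftSupport {p : P →ₗ[k] X} {U : Submodule k (P ⊗[k] Q)}
    (hU : SpannedBySimple U) {S : Submodule k P}
    (hS : ∀ b, p b ∈ leftSupport p U → b ∈ S) : U ≤ tensorSub k S ⊤ := by
  conv_lhs => rw [hU]
  refine Submodule.span_le.2 ?_
  rintro _ ⟨hv, b, c, rfl⟩
  rcases eq_or_ne c 0 with rfl | hc
  · rw [TensorProduct.tmul_zero]
    exact zero_mem _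
  · exact Submodule.subset_span
      ⟨b, hS b (Submodule.subset_span ⟨b, c, hc, hv, rfl⟩), c, trivial, rfl⟩

theorem map_comm_map_comm (U : Submodule k (P ⊗[k] Q)) :
    (U.map (TensorProduct.comm k P Q).toLinearMap).map
      (TensorProduct.comm k Q P).toLinearMap = U := by
  rw [← Submodule.map_comp, show (TensorProduct.comm k Q P).toLinearMap ∘ₗ
    (TensorProduct.comm k P Q).toLinearMap = LinearMap.id by ext; rfl, Submodule.map_id]

theorem exists_simple_spanning [FiniteDimensional k P] [FiniteDimensional k Q]
    (W : Submodule k (P ⊗[k] Q)) :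
    {r | ∃ s : Fin r → P ⊗[k] Q, (∀ i, ∃ b c, s i = b ⊗ₜ[k] c) ∧
      W ≤ Submodule.span k (Set.range s)}.Nonempty := by
  obtain ⟨s, hs, hspan, -⟩ := Submodule.exists_fun_fin_finrank_span_eq k
    {v : P ⊗[k] Q | ∃ b c, b ⊗ₜ[k] c = v}
  refine ⟨_, s, fun i => ?_, ?_⟩
  · obtain ⟨b, c, h⟩ := hs i
    exact ⟨b, c, h.symm⟩
  · rw [hspan, TensorProduct.span_tmul_eq_top]
    exact le_top

theorem map_comm_tensorSub_le (S : Submodule k P) (T : Submodule k Q) :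
    (tensorSub k S T).map (TensorProduct.comm k P Q).toLinearMap ≤ tensorSub k T S := by
  rw [tensorSub, Submodule.map_span]
  refine Submodule.span_le.2 ?_
  rintro _ ⟨_, ⟨b, hb, c, hc, rfl⟩, rfl⟩
  exact Submodule.subset_span ⟨c, hc, b, hb, rfl⟩

theorem sRank_le_sRank_map_comm [FiniteDimensional k P] [FiniteDimensional k Q]
    (W : Submodule k (P ⊗[k] Q)) :
    sRank k W ≤ sRank k (W.map (TensorProduct.comm k P Q).toLinearMap) := by
  obtain ⟨s, hs, hW⟩ := Nat.sInf_mem (exists_simple_spanning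
    (W.map (TensorProduct.comm k P Q).toLinearMap))
  refine Nat.sInf_le ⟨TensorProduct.comm k Q P ∘ s, fun i => ?_, ?_⟩
  · obtain ⟨b, c, h⟩ := hs i
    exact ⟨c, b, congrArg (TensorProduct.comm k Q P) h⟩
  · have := Submodule.map_mono (f := (TensorProduct.comm k Q P).toLinearMap) hW
    rw [map_comm_map_comm, Submodule.map_span, ← Set.range_comp] at this
    exact this

theorem sRank_add_finrank_rightSupport_le [FiniteDimensional k P] [FiniteDimensional k Q]
    [FiniteDimensional k X] [FiniteDimensional k Y]
    (p : P →ₗ[k] X) (q : P →ₗ[k] Y) (j : Y →ₗ[k] P)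
    (hqj : q ∘ₗ j = LinearMap.id) (hpj : p ∘ₗ j = 0)
    {U : Submodule k (Q ⊗[k] P)} (hU : SpannedBySimple U)
    {W : Submodule k (Q ⊗[k] Y)} (hW : W.map (TensorProduct.map LinearMap.id j) ≤ U) :
    sRank k W + finrank k (leftSupport p (U.map (TensorProduct.comm k Q P).toLinearMap)) ≤
      finrank k U := by
  have hW' : (W.map (TensorProduct.comm k Q Y).toLinearMap).map
      (TensorProduct.map j LinearMap.id) ≤ U.map (TensorProduct.comm k Q P).toLinearMap := by
    rw [← Submodule.map_comp, show TensorProduct.map j LinearMap.id ∘ₗ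
      (TensorProduct.comm k Q Y).toLinearMap = (TensorProduct.comm k Q P).toLinearMap ∘ₗ
        TensorProduct.map LinearMap.id j by ext; rfl, Submodule.map_comp]
    exact Submodule.map_mono hW
  have h := sRank_add_finrank_leftSupport_le p q j hqj hpj
    (hU.map (TensorProduct.comm k Q P).toLinearMap fun b c => ⟨c, b, rfl⟩) hW'
  rw [LinearEquiv.finrank_map_eq] at h
  exact (Nat.add_le_add_right (sRank_le_sRank_map_comm W) _).trans h

theorem le_tensorSub_of_rightSupport {p : P →ₗ[k] X} {U : Submodule k (Q ⊗[k] P)}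
    (hU : SpannedBySimple U) {S : Submodule k P}
    (hS : ∀ b, p b ∈ leftSupport p (U.map (TensorProduct.comm k Q P).toLinearMap) → b ∈ S) :
    U ≤ tensorSub k ⊤ S := by
  have h := le_tensorSub_of_leftSupport
    (hU.map (TensorProduct.comm k Q P).toLinearMap fun b c => ⟨c, b, rfl⟩) hS
  have := Submodule.map_mono (f := (TensorProduct.comm k P Q).toLinearMap) h
  rw [map_comm_map_comm] at this
  exact this.trans (map_comm_tensorSub_le S ⊤)

theorem finrank_map_tmul_map_of_injective {f : P →ₗ[k] X} {g : Q →ₗ[k] Y}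
    (hf : Function.Injective f) (hg : Function.Injective g) (W : Submodule k (P ⊗[k] Q)) :
    finrank k (W.map (TensorProduct.map f g)) = finrank k W :=
  (Submodule.equivMapOfInjective _
    (TensorProduct.map_injective_of_flat_flat f g hf hg) W).finrank_eq.symm

theorem mem_map_inl_sup_range_inr {S : Submodule k X} {b : X × Y} (hb : b.1 ∈ S) :
    b ∈ S.map (LinearMap.inl k X Y) ⊔ LinearMap.range (LinearMap.inr k X Y) :=
  Submodule.mem_sup.2 ⟨(b.1, 0), ⟨b.1, hb, rfl⟩, (0, b.2), ⟨b.2, rfl⟩, by simp⟩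

theorem mem_range_inl_sup_map_inr {S : Submodule k Y} {b : X × Y} (hb : b.2 ∈ S) :
    b ∈ LinearMap.range (LinearMap.inl k X Y) ⊔ S.map (LinearMap.inr k X Y) :=
  Submodule.mem_sup.2 ⟨(b.1, 0), ⟨b.1, rfl⟩, (0, b.2), ⟨b.2, hb, rfl⟩, by simp⟩

end Auxiliary

/-- If additivity fails, `R(W' ⊕ W'') < R(W') + R(W'')`, then the dimensions of the
minimal spaces `E', E'', F', F''` associated to a minimal decomposition `V` satisfy
`e' < R(W') − dim W'`, `f' < R(W') − dim W'`, `e'' < R(W'') − dim W''` and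
`f'' < R(W'') − dim W''`. -/
theorem dims_lt_gaps_of_additivity_fails {k : Type*} [Field k] {B' B'' C' C'' : Type*}
    [AddCommGroup B'] [Module k B'] [FiniteDimensional k B']
    [AddCommGroup B''] [Module k B''] [FiniteDimensional k B'']
    [AddCommGroup C'] [Module k C'] [FiniteDimensional k C']
    [AddCommGroup C''] [Module k C''] [FiniteDimensional k C'']
    (W' : Submodule k (B' ⊗[k] C')) (W'' : Submodule k (B'' ⊗[k] C''))
    (V : Submodule k ((B' × B'') ⊗[k] (C' × C'')))
    (hV : IsMinDecomp k (W'.map (ιL k B' B'' C' C'') ⊔ W''.map (ιR k B' B'' C' C'')) V)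
    (E' : Submodule k B') (hE' : IsEprimBound V E')
    (hE'min : ∀ E₀ : Submodule k B', IsEprimBound V E₀ → E' ≤ E₀)
    (E'' : Submodule k B'') (hE'' : IsEbisBound V E'')
    (hE''min : ∀ E₀ : Submodule k B'', IsEbisBound V E₀ → E'' ≤ E₀)
    (F' : Submodule k C') (hF' : IsFprimBound V F')
    (hF'min : ∀ F₀ : Submodule k C', IsFprimBound V F₀ → F' ≤ F₀)
    (F'' : Submodule k C'') (hF'' : IsFbisBound V F'')
    (hF''min : ∀ F₀ : Submodule k C'', IsFbisBound V F₀ → F'' ≤ F₀)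
    (hfail : sRank k (W'.map (ιL k B' B'' C' C'') ⊔ W''.map (ιR k B' B'' C' C'')) <
      sRank k W' + sRank k W'') :
    Module.finrank k E' + Module.finrank k W' < sRank k W' ∧
    Module.finrank k F' + Module.finrank k W' < sRank k W' ∧
    Module.finrank k E'' + Module.finrank k W'' < sRank k W'' ∧
    Module.finrank k F'' + Module.finrank k W'' < sRank k W'' := by
  obtain ⟨hWV, hVrank, hVspan⟩ := hV
  have hV : SpannedBySimple V := hVspan
  have hL : W'.map (ιL k B' B'' C' C'') ≤ V := le_sup_left.trans hWV
  have hR : W''.map (ιR k B' B'' C' C'') ≤ V := le_sup_right.trans hWV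
  have hdimL : Module.finrank k (W'.map (ιL k B' B'' C' C'')) = Module.finrank k W' :=
    finrank_map_tmul_map_of_injective LinearMap.inl_injective LinearMap.inl_injective W'
  have hdimR : Module.finrank k (W''.map (ιR k B' B'' C' C'')) = Module.finrank k W'' :=
    finrank_map_tmul_map_of_injective LinearMap.inr_injective LinearMap.inr_injective W''
  rw [← hVrank] at hfail
  refine ⟨?_, ?_, ?_, ?_⟩
  · have hU : SpannedBySimple (V.map (projCprim k B' B'' C' C'')) :=
      hV.map _ fun b c => ⟨b, c.2, rfl⟩
    have hmono := Submodule.finrank_mono (hE'min _ (le_tensorSub_of_leftSupport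
      (p := LinearMap.fst k B' B'') hU fun b hb => mem_map_inl_sup_range_inr hb))
    have hrank := sRank_add_finrank_leftSupport_le (LinearMap.fst k B' B'')
      (LinearMap.snd k B' B'') (LinearMap.inr k B' B'') rfl rfl
      hU (W := W'') (map_le_map_of_comp_eq (by
        ext; simp [projCprim, ιR]) hR)
    have hker := finrank_map_add_finrank_le (projCprim k B' B'' C' C'') hL (map_le_ker_of_comp_eq_zero (by
      ext; simp [projCprim, ιL]))
    omega
  · have hU : SpannedBySimple (V.map (projBprim k B' B'' C' C'')) :=
      hV.map _ fun b c => ⟨b.2, c, rfl⟩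
    have hmono := Submodule.finrank_mono (hF'min _ (le_tensorSub_of_rightSupport
      (p := LinearMap.fst k C' C'') hU fun b hb => mem_map_inl_sup_range_inr hb))
    have hrank := sRank_add_finrank_rightSupport_le (LinearMap.fst k C' C'')
      (LinearMap.snd k C' C'') (LinearMap.inr k C' C'') rfl rfl
      hU (W := W'') (map_le_map_of_comp_eq (by
        ext; simp [projBprim, ιR]) hR)
    have hker := finrank_map_add_finrank_le (projBprim k B' B'' C' C'') hL (map_le_ker_of_comp_eq_zero (by
      ext; simp [projBprim, ιL]))
    omega
  · have hU : SpannedBySimple (V.map (projCbis k B' B'' C' C'')) :=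
      hV.map _ fun b c => ⟨b, c.1, rfl⟩
    have hmono := Submodule.finrank_mono (hE''min _ (le_tensorSub_of_leftSupport
      (p := LinearMap.snd k B' B'') hU fun b hb => mem_range_inl_sup_map_inr hb))
    have hrank := sRank_add_finrank_leftSupport_le (LinearMap.snd k B' B'')
      (LinearMap.fst k B' B'') (LinearMap.inl k B' B'') rfl rfl
      hU (W := W') (map_le_map_of_comp_eq (by
        ext; simp [projCbis, ιL]) hL)
    have hker := finrank_map_add_finrank_le (projCbis k B' B'' C' C'') hR (map_le_ker_of_comp_eq_zero (by
      ext; simp [projCbis, ιR]))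
    omega
  · have hU : SpannedBySimple (V.map (projBbis k B' B'' C' C'')) :=
      hV.map _ fun b c => ⟨b.1, c, rfl⟩
    have hmono := Submodule.finrank_mono (hF''min _ (le_tensorSub_of_rightSupport
      (p := LinearMap.snd k C' C'') hU fun b hb => mem_range_inl_sup_map_inr hb))
    have hrank := sRank_add_finrank_rightSupport_le (LinearMap.snd k C' C'')
      (LinearMap.fst k C' C'') (LinearMap.inl k C' C'') rfl rfl
      hU (W := W') (map_le_map_of_comp_eq (by
        ext; simp [projBbis, ιL]) hL)
    have hker := finrank_map_add_finrank_le (projBbis k B' B'' C' C'') hR (map_le_ker_of_comp_eq_zero (by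
      ext; simp [projBbis, ιR]))
    omega
end

section
/- With W = W'⊕W'' and a fixed minimal decomposition V with associated spaces E', E'', F', F'': if at least one of E', E'', F', F'' is zero, then rank additivity holds: R(W) = R(W') + R(W''). In particular, if R(W') ≤ dim W' + 1, then R(W) = R(W') + R(W''). -/
open TensorProduct

section Rank

variable {k : Type*} [Field k] {B C D E : Type*} [AddCommGroup B] [Module k B]
  [AddCommGroup C] [Module k C] [AddCommGroup D] [Module k D] [AddCommGroup E] [Module k E]

/-- A spanning set of simple tensors bounds the rank by the dimension of its span. -/
theorem sRank_le_finrank_span [FiniteDimensional k B] [FiniteDimensional k C]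
    {W : Submodule k (B ⊗[k] C)} {S : Set (B ⊗[k] C)}
    (hS : ∀ x ∈ S, ∃ b c, x = b ⊗ₜ[k] c) (hW : W ≤ Submodule.span k S) :
    sRank k W ≤ Module.finrank k (Submodule.span k S) := by
  obtain ⟨T, hTS, hspan, hT⟩ := exists_linearIndependent k S
  have hfin : Finite T := hT.finite
  have : Fintype T := Fintype.ofFinite T
  have hcard : Module.finrank k (Submodule.span k S) = Fintype.card T := by
    rw [← hspan, ← finrank_span_eq_card hT, Subtype.range_coe]
  rw [hcard]
  refine Nat.sInf_le ⟨fun i => ((Fintype.equivFin T).symm i : B ⊗[k] C),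
    fun i => hS _ (hTS (Subtype.prop _)), ?_⟩
  have hrange : Set.range (fun i => ((Fintype.equivFin T).symm i : B ⊗[k] C)) = T := by
    rw [← Function.comp_def (Subtype.val) (Fintype.equivFin T).symm, Set.range_comp,
      Equiv.range_eq_univ, Set.image_univ, Subtype.range_coe]
  rwa [hrange, hspan]

/-- The rank is attained by a set of simple tensors. -/
theorem exists_finrank_span_le_sRank [FiniteDimensional k B] [FiniteDimensional k C]
    (W : Submodule k (B ⊗[k] C)) :
    ∃ S : Set (B ⊗[k] C), (∀ x ∈ S, ∃ b c, x = b ⊗ₜ[k] c) ∧ W ≤ Submodule.span k S ∧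
      Module.finrank k (Submodule.span k S) ≤ sRank k W := by
  have hne : {r | ∃ s : Fin r → B ⊗[k] C, (∀ i, ∃ b c, s i = b ⊗ₜ[k] c) ∧
      W ≤ Submodule.span k (Set.range s)}.Nonempty := by
    obtain ⟨T, hTS, hspan, hT⟩ := exists_linearIndependent k {t : B ⊗[k] C | ∃ b c, b ⊗ₜ c = t}
    have hfin : Finite T := hT.finite
    obtain ⟨n, ⟨e⟩⟩ := Finite.exists_equiv_fin T
    refine ⟨n, fun i => (e.symm i : B ⊗[k] C), fun i => ?_, ?_⟩
    · obtain ⟨b, c, h⟩ := hTS (e.symm i).2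
      exact ⟨b, c, h.symm⟩
    · have hrange : Set.range (fun i => (e.symm i : B ⊗[k] C)) = T := by
        rw [← Function.comp_def (Subtype.val) e.symm, Set.range_comp,
          Equiv.range_eq_univ, Set.image_univ, Subtype.range_coe]
      rw [hrange, hspan, TensorProduct.span_tmul_eq_top]
      exact le_top
  obtain ⟨s, hs, hW⟩ := Nat.sInf_mem hne
  refine ⟨Set.range s, ?_, hW, ?_⟩
  · rintro _ ⟨i, rfl⟩
    exact hs i
  · exact (finrank_range_le_card s).trans (Fintype.card_fin _).le

/-- If `V` is spanned by simple tensors, a product map `f ⊗ g` bounds the rank of every subspace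
of the image of `V` by the dimension of that image. -/
theorem sRank_le_finrank_map [FiniteDimensional k D] [FiniteDimensional k E]
    {V : Submodule k (B ⊗[k] C)}
    (hV : V = Submodule.span k {v | v ∈ V ∧ ∃ b c, v = b ⊗ₜ[k] c})
    (f : B →ₗ[k] D) (g : C →ₗ[k] E) {W : Submodule k (D ⊗[k] E)}
    (hW : W ≤ V.map (TensorProduct.map f g)) :
    sRank k W ≤ Module.finrank k (V.map (TensorProduct.map f g)) := by
  have hmap : V.map (TensorProduct.map f g) = Submodule.span k
      (TensorProduct.map f g '' {v | v ∈ V ∧ ∃ b c, v = b ⊗ₜ[k] c}) := by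
    rw [← Submodule.map_span, ← hV]
  rw [hmap] at hW ⊢
  refine sRank_le_finrank_span ?_ hW
  rintro _ ⟨_, ⟨-, b, c, rfl⟩, rfl⟩
  exact ⟨f b, g c, TensorProduct.map_tmul ..⟩

theorem finrank_add_finrank_map_le_of_le_ker [FiniteDimensional k B] {V K : Submodule k B}
    (q : B →ₗ[k] D) (hKV : K ≤ V) (hKq : K ≤ LinearMap.ker q) :
    Module.finrank k K + Module.finrank k (V.map q) ≤ Module.finrank k V := by
  have hrank := (q.domRestrict V).finrank_range_add_finrank_ker
  rw [LinearMap.range_domRestrict] at hrank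
  have hle : K.submoduleOf V ≤ LinearMap.ker (q.domRestrict V) := fun x hx => hKq hx
  have hK := Submodule.finrank_mono hle
  rw [(Submodule.submoduleOfEquivOfLe hKV).finrank_eq] at hK
  omega

/-- If each vector of a spanning set of `V` is killed by `p` or by `q`, the dimensions of the
images of `V` add up to at most the dimension of `V`. -/
theorem finrank_map_add_finrank_map_le [FiniteDimensional k B] {V : Submodule k B} {S : Set B}
    (hV : V = Submodule.span k S) (p : B →ₗ[k] D) (q : B →ₗ[k] E)
    (h : ∀ x ∈ S, p x = 0 ∨ q x = 0) :
    Module.finrank k (V.map p) + Module.finrank k (V.map q) ≤ Module.finrank k V := by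
  have hp : V.map p ≤ (V ⊓ LinearMap.ker q).map p := by
    conv_lhs => rw [hV]
    rw [Submodule.map_span, Submodule.span_le]
    rintro _ ⟨x, hx, rfl⟩
    obtain hpx | hqx := h x hx
    · rw [hpx]
      exact zero_mem _
    · exact ⟨x, ⟨hV ▸ Submodule.subset_span hx, hqx⟩, rfl⟩
  have hle := (Submodule.finrank_mono hp).trans (Submodule.finrank_map_le p _)
  have hq := finrank_add_finrank_map_le_of_le_ker q
    (inf_le_left : V ⊓ LinearMap.ker q ≤ V) inf_le_right
  omega

theorem eq_zero_or_eq_zero_of_tmul_eq_zero {b : B} {c : C} (h : b ⊗ₜ[k] c = 0) :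
    b = 0 ∨ c = 0 := by
  by_contra! hbc
  obtain ⟨f, hf⟩ := Module.Projective.exists_dual_eq_one k hbc.1
  have hc := congrArg ((TensorProduct.lid k C).toLinearMap ∘ₗ TensorProduct.map f LinearMap.id) h
  exact hbc.2 (by simpa [hf] using hc)

theorem map_eq_zero_of_mem_tensorSub {S : Submodule k B} {T : Submodule k C}
    (f : B →ₗ[k] D) (g : C →ₗ[k] E) (h : ∀ b ∈ S, ∀ c ∈ T, f b ⊗ₜ[k] g c = 0)
    {x : B ⊗[k] C} (hx : x ∈ tensorSub k S T) : TensorProduct.map f g x = 0 := by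
  have hle : tensorSub k S T ≤ LinearMap.ker (TensorProduct.map f g) := by
    refine Submodule.span_le.2 ?_
    rintro _ ⟨b, hb, c, hc, rfl⟩
    exact h b hb c hc
  exact hle hx

end Rank

section DirectSum

variable {k : Type*} [Field k] {B' B'' C' C'' : Type*}
  [AddCommGroup B'] [Module k B'] [AddCommGroup B''] [Module k B'']
  [AddCommGroup C'] [Module k C'] [AddCommGroup C''] [Module k C'']

theorem map_ιL {D E : Type*} [AddCommGroup D] [Module k D] [AddCommGroup E] [Module k E]
    (f : B' × B'' →ₗ[k] D) (g : C' × C'' →ₗ[k] E) (x : B' ⊗[k] C') :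
    TensorProduct.map f g (ιL k B' B'' C' C'' x) =
      TensorProduct.map (f ∘ₗ LinearMap.inl k B' B'') (g ∘ₗ LinearMap.inl k C' C'') x := by
  rw [TensorProduct.map_comp]
  rfl

theorem map_ιR {D E : Type*} [AddCommGroup D] [Module k D] [AddCommGroup E] [Module k E]
    (f : B' × B'' →ₗ[k] D) (g : C' × C'' →ₗ[k] E) (x : B'' ⊗[k] C'') :
    TensorProduct.map f g (ιR k B' B'' C' C'' x) =
      TensorProduct.map (f ∘ₗ LinearMap.inr k B' B'') (g ∘ₗ LinearMap.inr k C' C'') x := by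
  rw [TensorProduct.map_comp]
  rfl

/-- A product map restricting to the identity on `B' ⊗ C'` retracts `W'`. -/
theorem le_map_of_comp_inl {W' : Submodule k (B' ⊗[k] C')}
    {V : Submodule k ((B' × B'') ⊗[k] (C' × C''))} (hW : W'.map (ιL k B' B'' C' C'') ≤ V)
    {f : B' × B'' →ₗ[k] B'} {g : C' × C'' →ₗ[k] C'}
    (hf : f ∘ₗ LinearMap.inl k B' B'' = LinearMap.id)
    (hg : g ∘ₗ LinearMap.inl k C' C'' = LinearMap.id) :
    W' ≤ V.map (TensorProduct.map f g) := fun x hx =>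
  ⟨_, hW ⟨x, hx, rfl⟩, by rw [map_ιL, hf, hg, TensorProduct.map_id, LinearMap.id_apply]⟩

/-- A product map restricting to the identity on `B'' ⊗ C''` retracts `W''`. -/
theorem le_map_of_comp_inr {W'' : Submodule k (B'' ⊗[k] C'')}
    {V : Submodule k ((B' × B'') ⊗[k] (C' × C''))} (hW : W''.map (ιR k B' B'' C' C'') ≤ V)
    {f : B' × B'' →ₗ[k] B''} {g : C' × C'' →ₗ[k] C''}
    (hf : f ∘ₗ LinearMap.inr k B' B'' = LinearMap.id)
    (hg : g ∘ₗ LinearMap.inr k C' C'' = LinearMap.id) :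
    W'' ≤ V.map (TensorProduct.map f g) := fun x hx =>
  ⟨_, hW ⟨x, hx, rfl⟩, by rw [map_ιR, hf, hg, TensorProduct.map_id, LinearMap.id_apply]⟩

variable [FiniteDimensional k B'] [FiniteDimensional k B'']
  [FiniteDimensional k C'] [FiniteDimensional k C'']

/-- Subadditivity of the rank. -/
theorem sRank_directSum_le (W' : Submodule k (B' ⊗[k] C')) (W'' : Submodule k (B'' ⊗[k] C'')) :
    sRank k (W'.map (ιL k B' B'' C' C'') ⊔ W''.map (ιR k B' B'' C' C'')) ≤
      sRank k W' + sRank k W'' := by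
  obtain ⟨S', hS', hW', hr'⟩ := exists_finrank_span_le_sRank W'
  obtain ⟨S'', hS'', hW'', hr''⟩ := exists_finrank_span_le_sRank W''
  have hspan : Submodule.span k (ιL k B' B'' C' C'' '' S' ∪ ιR k B' B'' C' C'' '' S'') =
      (Submodule.span k S').map (ιL k B' B'' C' C'') ⊔
        (Submodule.span k S'').map (ιR k B' B'' C' C'') := by
    rw [Submodule.span_union, Submodule.map_span, Submodule.map_span]
  have hle : sRank k (W'.map (ιL k B' B'' C' C'') ⊔ W''.map (ιR k B' B'' C' C'')) ≤
      Module.finrank k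
        (Submodule.span k (ιL k B' B'' C' C'' '' S' ∪ ιR k B' B'' C' C'' '' S'')) := by
    refine sRank_le_finrank_span ?_ ?_
    · rintro _ (⟨x, hx, rfl⟩ | ⟨x, hx, rfl⟩)
      · obtain ⟨b, c, rfl⟩ := hS' x hx
        exact ⟨_, _, TensorProduct.map_tmul ..⟩
      · obtain ⟨b, c, rfl⟩ := hS'' x hx
        exact ⟨_, _, TensorProduct.map_tmul ..⟩
    · rw [hspan]
      exact sup_le_sup (Submodule.map_mono hW') (Submodule.map_mono hW'')
  rw [hspan] at hle
  have hsup := Submodule.finrank_add_le_finrank_add_finrank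
    ((Submodule.span k S').map (ιL k B' B'' C' C''))
    ((Submodule.span k S'').map (ιR k B' B'' C' C''))
  have hL := Submodule.finrank_map_le (ιL k B' B'' C' C'') (Submodule.span k S')
  have hR := Submodule.finrank_map_le (ιR k B' B'' C' C'') (Submodule.span k S'')
  omega

/-- Additivity holds if every simple tensor of a minimal decomposition vanishes in `B' ⊗ C'` or
in `B'' ⊗ C''`. -/
theorem sRank_directSum_eq_of_forall {W' : Submodule k (B' ⊗[k] C')}
    {W'' : Submodule k (B'' ⊗[k] C'')} {V : Submodule k ((B' × B'') ⊗[k] (C' × C''))}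
    (hV : IsMinDecomp k (W'.map (ιL k B' B'' C' C'') ⊔ W''.map (ιR k B' B'' C' C'')) V)
    (h : ∀ b c, b ⊗ₜ[k] c ∈ V → (b.1 = 0 ∨ c.1 = 0) ∨ (b.2 = 0 ∨ c.2 = 0)) :
    sRank k (W'.map (ιL k B' B'' C' C'') ⊔ W''.map (ιR k B' B'' C' C'')) =
      sRank k W' + sRank k W'' := by
  obtain ⟨hWV, hrank, hspan⟩ := hV
  refine le_antisymm (sRank_directSum_le W' W'') ?_
  rw [← hrank]
  refine le_trans (add_le_add
    (sRank_le_finrank_map hspan (LinearMap.fst k B' B'') (LinearMap.fst k C' C'')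
      (le_map_of_comp_inl (le_sup_left.trans hWV) (LinearMap.fst_comp_inl ..)
        (LinearMap.fst_comp_inl ..)))
    (sRank_le_finrank_map hspan (LinearMap.snd k B' B'') (LinearMap.snd k C' C'')
      (le_map_of_comp_inr (le_sup_right.trans hWV) (LinearMap.snd_comp_inr ..)
        (LinearMap.snd_comp_inr ..))))
    (finrank_map_add_finrank_map_le hspan _ _ ?_)
  rintro _ ⟨hx, b, c, rfl⟩
  obtain (hb | hc) | (hb | hc) := h b c hx <;> simp [*]

/-- A simple tensor of a minimal decomposition that does not lie in `B'' ⊗ C` or `B ⊗ C'` improves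
the bound `dim W' + R(W'') ≤ R(W' ⊕ W'')` by one. -/
theorem finrank_add_one_add_sRank_le {W' : Submodule k (B' ⊗[k] C')}
    {W'' : Submodule k (B'' ⊗[k] C'')} {V : Submodule k ((B' × B'') ⊗[k] (C' × C''))}
    (hV : IsMinDecomp k (W'.map (ιL k B' B'' C' C'') ⊔ W''.map (ιR k B' B'' C' C'')) V)
    {b : B' × B''} {c : C' × C''} (hbc : b ⊗ₜ[k] c ∈ V) (hb : b.1 ≠ 0) (hc : c.2 ≠ 0) :
    Module.finrank k W' + 1 + sRank k W'' ≤
      sRank k (W'.map (ιL k B' B'' C' C'') ⊔ W''.map (ιR k B' B'' C' C'')) := by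
  obtain ⟨hWV, hrank, hspan⟩ := hV
  obtain ⟨φ, hφ⟩ := Module.Projective.exists_dual_eq_one k hb
  let f : B' × B'' →ₗ[k] B'' :=
    LinearMap.snd k B' B'' - (φ.smulRight b.2) ∘ₗ LinearMap.fst k B' B''
  have hfb : f b = 0 := by simp [f, hφ]
  have hf : f ∘ₗ LinearMap.inr k B' B'' = LinearMap.id := by
    ext x
    simp [f]
  have hR := sRank_le_finrank_map hspan f (LinearMap.snd k C' C'')
    (le_map_of_comp_inr (le_sup_right.trans hWV) hf (LinearMap.snd_comp_inr ..))
  set L := W'.map (ιL k B' B'' C' C'') with hL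
  set K := L ⊔ Submodule.span k {b ⊗ₜ[k] c} with hK
  have hKV : K ≤ V := sup_le (le_sup_left.trans hWV) (by simpa using hbc)
  have hKer : K ≤ LinearMap.ker (TensorProduct.map f (LinearMap.snd k C' C'')) := by
    refine sup_le ?_ ?_
    · rintro _ ⟨x, -, rfl⟩
      rw [LinearMap.mem_ker, map_ιL, LinearMap.snd_comp_inl, TensorProduct.map_zero_right,
        LinearMap.zero_apply]
    · simp [hfb]
  have hmem : b ⊗ₜ[k] c ∉ L := by
    rintro ⟨x, -, hx⟩
    have h0 := congrArg (TensorProduct.map (LinearMap.fst k B' B'') (LinearMap.snd k C' C'')) hx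
    rw [map_ιL, LinearMap.snd_comp_inl, TensorProduct.map_zero_right, LinearMap.zero_apply,
      TensorProduct.map_tmul] at h0
    exact (eq_zero_or_eq_zero_of_tmul_eq_zero h0.symm).elim hb hc
  have hlt : L < K := by
    refine lt_of_le_of_ne le_sup_left fun h => hmem ?_
    rw [h]
    exact (le_sup_right : _ ≤ K) (Submodule.mem_span_singleton_self _)
  have hLK := Submodule.finrank_lt_finrank_of_lt hlt
  have hW'L : Module.finrank k W' ≤ Module.finrank k L :=
    (Submodule.finrank_mono (le_map_of_comp_inl (V := L) le_rfl (LinearMap.fst_comp_inl ..)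
      (LinearMap.fst_comp_inl ..))).trans (Submodule.finrank_map_le _ _)
  have hsum := finrank_add_finrank_map_le_of_le_ker _ hKV hKer
  omega

end DirectSum

/-- If one of the minimal spaces `E', E'', F', F''` associated to a minimal decomposition
is zero, then additivity holds: `R(W' ⊕ W'') = R(W') + R(W'')`. In particular, additivity
holds whenever `R(W') ≤ dim W' + 1`. -/
theorem additivity_of_some_zero {k : Type*} [Field k] {B' B'' C' C'' : Type*}
    [AddCommGroup B'] [Module k B'] [FiniteDimensional k B']
    [AddCommGroup B''] [Module k B''] [FiniteDimensional k B'']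
    [AddCommGroup C'] [Module k C'] [FiniteDimensional k C']
    [AddCommGroup C''] [Module k C''] [FiniteDimensional k C'']
    (W' : Submodule k (B' ⊗[k] C')) (W'' : Submodule k (B'' ⊗[k] C''))
    (V : Submodule k ((B' × B'') ⊗[k] (C' × C'')))
    (hV : IsMinDecomp k (W'.map (ιL k B' B'' C' C'') ⊔ W''.map (ιR k B' B'' C' C'')) V)
    (E' : Submodule k B') (hE' : IsEprimBound V E')
    (hE'min : ∀ E₀ : Submodule k B', IsEprimBound V E₀ → E' ≤ E₀)
    (E'' : Submodule k B'') (hE'' : IsEbisBound V E'')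
    (hE''min : ∀ E₀ : Submodule k B'', IsEbisBound V E₀ → E'' ≤ E₀)
    (F' : Submodule k C') (hF' : IsFprimBound V F')
    (hF'min : ∀ F₀ : Submodule k C', IsFprimBound V F₀ → F' ≤ F₀)
    (F'' : Submodule k C'') (hF'' : IsFbisBound V F'')
    (hF''min : ∀ F₀ : Submodule k C'', IsFbisBound V F₀ → F'' ≤ F₀) :
    ((E' = ⊥ ∨ E'' = ⊥ ∨ F' = ⊥ ∨ F'' = ⊥) →
      sRank k (W'.map (ιL k B' B'' C' C'') ⊔ W''.map (ιR k B' B'' C' C'')) =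
        sRank k W' + sRank k W'') ∧
    (sRank k W' ≤ Module.finrank k W' + 1 →
      sRank k (W'.map (ιL k B' B'' C' C'') ⊔ W''.map (ιR k B' B'' C' C'')) =
        sRank k W' + sRank k W'') := by
  refine ⟨?_, fun hle => ?_⟩
  · rintro (rfl | rfl | rfl | rfl) <;> refine sRank_directSum_eq_of_forall hV fun b c hbc => ?_
    · have h := map_eq_zero_of_mem_tensorSub (LinearMap.fst k B' B'') LinearMap.id
        (by rintro b hb c -; obtain ⟨y, rfl⟩ := (by simpa using hb); simp) (hE' ⟨_, hbc, rfl⟩)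
      rw [projCprim, TensorProduct.map_tmul, TensorProduct.map_tmul] at h
      obtain h | h := eq_zero_or_eq_zero_of_tmul_eq_zero h <;> simp_all
    · have h := map_eq_zero_of_mem_tensorSub (LinearMap.snd k B' B'') LinearMap.id
        (by rintro b hb c -; obtain ⟨y, rfl⟩ := (by simpa using hb); simp) (hE'' ⟨_, hbc, rfl⟩)
      rw [projCbis, TensorProduct.map_tmul, TensorProduct.map_tmul] at h
      obtain h | h := eq_zero_or_eq_zero_of_tmul_eq_zero h <;> simp_all
    · have h := map_eq_zero_of_mem_tensorSub LinearMap.id (LinearMap.fst k C' C'')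
        (by rintro b - c hc; obtain ⟨y, rfl⟩ := (by simpa using hc); simp) (hF' ⟨_, hbc, rfl⟩)
      rw [projBprim, TensorProduct.map_tmul, TensorProduct.map_tmul] at h
      obtain h | h := eq_zero_or_eq_zero_of_tmul_eq_zero h <;> simp_all
    · have h := map_eq_zero_of_mem_tensorSub LinearMap.id (LinearMap.snd k C' C'')
        (by rintro b - c hc; obtain ⟨y, rfl⟩ := (by simpa using hc); simp) (hF'' ⟨_, hbc, rfl⟩)
      rw [projBbis, TensorProduct.map_tmul, TensorProduct.map_tmul] at h
      obtain h | h := eq_zero_or_eq_zero_of_tmul_eq_zero h <;> simp_all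
  · by_cases h : ∀ b c, b ⊗ₜ[k] c ∈ V → b.1 = 0 ∨ c.2 = 0
    · exact sRank_directSum_eq_of_forall hV fun b c hbc => (h b c hbc).imp Or.inl Or.inr
    · push Not at h
      obtain ⟨b, c, hbc, hb, hc⟩ := h
      have hlow := finrank_add_one_add_sRank_le hV hbc hb hc
      have hup := sRank_directSum_le W' W''
      omega
end

section
/- Over any field k, if W' ⊆ B'⊗C' is a (1,2)-hook shaped linear subspace and W'' ⊆ B''⊗C'' is arbitrary, then rank additivity holds: R(W'⊕W'') = R(W') + R(W''). -/
open TensorProduct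

section SimpleSpan

variable {k : Type*} [Field k] {B C D X Y : Type*}
  [AddCommGroup B] [Module k B] [AddCommGroup C] [Module k C]
  [AddCommGroup D] [Module k D] [AddCommGroup X] [Module k X] [AddCommGroup Y] [Module k Y]

theorem finrank_map_add_finrank_inf_ker [FiniteDimensional k B] (f : B →ₗ[k] D)
    (V : Submodule k B) :
    Module.finrank k (V.map f) + Module.finrank k (V ⊓ LinearMap.ker f : Submodule k B) =
      Module.finrank k V := by
  rw [← LinearMap.finrank_range_add_finrank_ker (f.domRestrict V), LinearMap.range_domRestrict,
    LinearMap.ker_domRestrict, ← Submodule.finrank_map_subtype_eq V,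
    Submodule.map_comap_subtype]

variable (k) in
/-- The span of the simple tensors `b ⊗ c` with `(b, c) ∈ S`. -/
noncomputable def simpleSpan (S : Set (B × C)) : Submodule k (B ⊗[k] C) :=
  Submodule.span k ((fun p : B × C => p.1 ⊗ₜ[k] p.2) '' S)

theorem tmul_mem_simpleSpan {S : Set (B × C)} {p : B × C} (hp : p ∈ S) :
    p.1 ⊗ₜ[k] p.2 ∈ simpleSpan k S :=
  Submodule.subset_span ⟨p, hp, rfl⟩

theorem simpleSpan_le {S : Set (B × C)} {V : Submodule k (B ⊗[k] C)} :
    simpleSpan k S ≤ V ↔ ∀ p ∈ S, p.1 ⊗ₜ[k] p.2 ∈ V := by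
  simp only [simpleSpan, Submodule.span_le, Set.image_subset_iff]
  rfl

theorem map_simpleSpan (f : B →ₗ[k] X) (g : C →ₗ[k] Y) (S : Set (B × C)) :
    (simpleSpan k S).map (TensorProduct.map f g) = simpleSpan k (Prod.map f g '' S) := by
  rw [simpleSpan, simpleSpan, Submodule.map_span, Set.image_image, Set.image_image]
  rfl

theorem simpleSpan_union (S T : Set (B × C)) :
    simpleSpan k (S ∪ T) = simpleSpan k S ⊔ simpleSpan k T := by
  rw [simpleSpan, Set.image_union, Submodule.span_union]; rfl

theorem simpleSpan_univ : simpleSpan k (Set.univ : Set (B × C)) = ⊤ := by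
  rw [← TensorProduct.span_tmul_eq_top, simpleSpan]
  congr 1
  ext x
  simp

theorem exists_fin_simpleSpan [FiniteDimensional k B] [FiniteDimensional k C]
    (S : Set (B × C)) :
    ∃ s : Fin (Module.finrank k (simpleSpan k S)) → B ⊗[k] C,
      (∀ i, ∃ b c, s i = b ⊗ₜ[k] c) ∧ simpleSpan k S = Submodule.span k (Set.range s) := by
  obtain ⟨b, hb, hspan, hli⟩ :=
    exists_linearIndependent k ((fun p : B × C => p.1 ⊗ₜ[k] p.2) '' S)
  have : Finite b := hli.finite
  have := Fintype.ofFinite b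
  have hcard : Module.finrank k (simpleSpan k S) = Fintype.card b := by
    rw [simpleSpan, ← hspan, ← finrank_span_eq_card hli, Subtype.range_coe]
  let e := (Fintype.equivFinOfCardEq hcard.symm).symm
  refine ⟨fun i => e i, fun i => ?_, ?_⟩
  · obtain ⟨p, -, hp⟩ := hb (e i).2
    exact ⟨p.1, p.2, hp.symm⟩
  · rw [show (fun i => (e i : B ⊗[k] C)) = Subtype.val ∘ e from rfl, e.surjective.range_comp,
      Subtype.range_coe, hspan, simpleSpan]

theorem sRank_le_finrank_simpleSpan [FiniteDimensional k B] [FiniteDimensional k C]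
    {W : Submodule k (B ⊗[k] C)} {S : Set (B × C)} (h : W ≤ simpleSpan k S) :
    sRank k W ≤ Module.finrank k (simpleSpan k S) := by
  obtain ⟨s, hs, hspan⟩ := exists_fin_simpleSpan (k := k) S
  exact Nat.sInf_le ⟨s, hs, hspan ▸ h⟩

theorem exists_simpleSpan_finrank_le_sRank [FiniteDimensional k B] [FiniteDimensional k C]
    (W : Submodule k (B ⊗[k] C)) :
    ∃ S : Set (B × C), W ≤ simpleSpan k S ∧ Module.finrank k (simpleSpan k S) ≤ sRank k W := by
  obtain ⟨s₀, hs₀, hspan⟩ := exists_fin_simpleSpan (k := k) (Set.univ : Set (B × C))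
  have hne : {r | ∃ s : Fin r → B ⊗[k] C, (∀ i, ∃ b c, s i = b ⊗ₜ[k] c) ∧
    W ≤ Submodule.span k (Set.range s)}.Nonempty :=
    ⟨_, s₀, hs₀, by rw [← hspan, simpleSpan_univ]; exact le_top⟩
  obtain ⟨s, hs, hW⟩ := Nat.sInf_mem hne
  choose b c hbc using hs
  have hS : simpleSpan k (Set.range fun i => (b i, c i)) = Submodule.span k (Set.range s) := by
    rw [simpleSpan, ← Set.range_comp]
    congr 2
    ext1 i
    exact (hbc i).symm
  refine ⟨_, hS ▸ hW, ?_⟩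
  rw [hS]
  exact (finrank_range_le_card s).trans (Fintype.card_fin _).le

variable [FiniteDimensional k B] [FiniteDimensional k C]
  [FiniteDimensional k X] [FiniteDimensional k Y]

theorem sRank_mono {W₁ W₂ : Submodule k (B ⊗[k] C)} (h : W₁ ≤ W₂) : sRank k W₁ ≤ sRank k W₂ := by
  obtain ⟨S, hS, hr⟩ := exists_simpleSpan_finrank_le_sRank W₂
  exact (sRank_le_finrank_simpleSpan (h.trans hS)).trans hr

theorem sRank_sup_le (W₁ W₂ : Submodule k (B ⊗[k] C)) :
    sRank k (W₁ ⊔ W₂) ≤ sRank k W₁ + sRank k W₂ := by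
  obtain ⟨S₁, hS₁, hr₁⟩ := exists_simpleSpan_finrank_le_sRank W₁
  obtain ⟨S₂, hS₂, hr₂⟩ := exists_simpleSpan_finrank_le_sRank W₂
  have h : W₁ ⊔ W₂ ≤ simpleSpan k (S₁ ∪ S₂) := by
    rw [simpleSpan_union]; exact sup_le_sup hS₁ hS₂
  refine (sRank_le_finrank_simpleSpan h).trans ?_
  rw [simpleSpan_union]
  exact (Submodule.finrank_add_le_finrank_add_finrank _ _).trans (Nat.add_le_add hr₁ hr₂)

theorem sRank_map_le (f : B →ₗ[k] X) (g : C →ₗ[k] Y) (W : Submodule k (B ⊗[k] C)) :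
    sRank k (W.map (TensorProduct.map f g)) ≤ sRank k W := by
  obtain ⟨S, hS, hr⟩ := exists_simpleSpan_finrank_le_sRank W
  have h := Submodule.map_mono (f := TensorProduct.map f g) hS
  rw [map_simpleSpan] at h
  refine (sRank_le_finrank_simpleSpan h).trans ?_
  rw [← map_simpleSpan]
  exact (Submodule.finrank_map_le _ _).trans hr

theorem sRank_le_finrank_of_forall_simple {W : Submodule k (B ⊗[k] C)}
    (h : ∀ w ∈ W, ∃ b c, w = b ⊗ₜ[k] c) : sRank k W ≤ Module.finrank k W := by
  have hW : simpleSpan k {p : B × C | p.1 ⊗ₜ[k] p.2 ∈ W} = W := by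
    refine le_antisymm (simpleSpan_le.2 fun p hp => hp) fun w hw => ?_
    obtain ⟨b, c, rfl⟩ := h w hw
    exact tmul_mem_simpleSpan (S := {p : B × C | p.1 ⊗ₜ[k] p.2 ∈ W}) (p := (b, c)) hw
  have := sRank_le_finrank_simpleSpan hW.ge
  rwa [hW] at this

theorem sRank_span_le {ι : Type*} [Fintype ι] (b : ι → B) (c : ι → C)
    {W : Submodule k (B ⊗[k] C)}
    (h : W ≤ Submodule.span k (Set.range fun i => b i ⊗ₜ[k] c i)) :
    sRank k W ≤ Fintype.card ι := by
  have hS : simpleSpan k (Set.range fun i => (b i, c i)) =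
      Submodule.span k (Set.range fun i => b i ⊗ₜ[k] c i) := by
    rw [simpleSpan, ← Set.range_comp]; rfl
  refine (sRank_le_finrank_simpleSpan (hS ▸ h)).trans ?_
  rw [hS]
  exact finrank_range_le_card _

end SimpleSpan

section Pencil

variable {k : Type*} [Field k] {E F : Type*} [AddCommGroup E] [Module k E] [AddCommGroup F]
  [Module k F]

theorem exists_eq_tmul_of_finrank_left_le_one [FiniteDimensional k E]
    (hE : Module.finrank k E ≤ 1) (w : E ⊗[k] F) : ∃ b c, w = b ⊗ₜ[k] c := by
  obtain ⟨v, hv⟩ := finrank_le_one_iff.1 hE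
  suffices ∃ c, w = v ⊗ₜ[k] c from ⟨v, this⟩
  induction w with
  | zero => exact ⟨0, by simp⟩
  | tmul x y =>
    obtain ⟨a, rfl⟩ := hv x
    exact ⟨a • y, TensorProduct.smul_tmul _ _ _⟩
  | add x y hx hy =>
    obtain ⟨c, rfl⟩ := hx
    obtain ⟨d, rfl⟩ := hy
    exact ⟨c + d, (TensorProduct.tmul_add _ _ _).symm⟩

theorem exists_eq_tmul_of_finrank_right_le_one [FiniteDimensional k F]
    (hF : Module.finrank k F ≤ 1) (w : E ⊗[k] F) : ∃ b c, w = b ⊗ₜ[k] c := by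
  obtain ⟨c, b, h⟩ := exists_eq_tmul_of_finrank_left_le_one hF (TensorProduct.comm k E F w)
  exact ⟨b, c, (TensorProduct.comm k E F).injective (by simpa using h)⟩

/-- The `i`-th slice of a tensor with respect to a basis of the second factor. -/
noncomputable def slice {ι : Type*} (u : Module.Basis ι k F) (i : ι) : E ⊗[k] F →ₗ[k] E :=
  (TensorProduct.rid k E).toLinearMap ∘ₗ TensorProduct.map LinearMap.id (u.coord i)

theorem eq_slice_tmul_add_slice_tmul (u : Module.Basis (Fin 2) k F) (w : E ⊗[k] F) :
    w = slice u 0 w ⊗ₜ[k] u 0 + slice u 1 w ⊗ₜ[k] u 1 := by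
  induction w with
  | zero => simp
  | tmul x y =>
    conv_lhs => rw [← u.sum_repr y, Fin.sum_univ_two, TensorProduct.tmul_add]
    simp [slice, TensorProduct.smul_tmul]
  | add x y hx hy =>
    conv_lhs => rw [hx, hy]
    simp only [map_add, TensorProduct.add_tmul]
    abel

variable [FiniteDimensional k E] [FiniteDimensional k F]

theorem sRank_le_two_mul_finrank (u : Module.Basis (Fin 2) k F) (K : Submodule k (E ⊗[k] F)) :
    sRank k K ≤ 2 * Module.finrank k K := by
  let b := Module.finBasis k K
  have h : K ≤ Submodule.span k (Set.range fun p : Fin 2 × Fin (Module.finrank k K) =>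
      slice u p.1 (b p.2 : E ⊗[k] F) ⊗ₜ[k] u p.1) := by
    have hK : K = Submodule.span k (Set.range fun j => (b j : E ⊗[k] F)) := by
      rw [show (fun j => (b j : E ⊗[k] F)) = K.subtype ∘ b from rfl, Set.range_comp,
        ← Submodule.map_span, b.span_eq, Submodule.map_top, Submodule.range_subtype]
    conv_lhs => rw [hK]
    rw [Submodule.span_le]
    rintro _ ⟨j, rfl⟩
    simp only [SetLike.mem_coe]
    rw [eq_slice_tmul_add_slice_tmul u (b j : E ⊗[k] F)]
    exact add_mem (Submodule.subset_span ⟨(0, j), rfl⟩) (Submodule.subset_span ⟨(1, j), rfl⟩)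
  simpa using sRank_span_le _ _ h

theorem sRank_le_finrank_mul_finrank (K : Submodule k (E ⊗[k] F)) :
    sRank k K ≤ Module.finrank k E * Module.finrank k F := by
  let b := Module.finBasis k E
  let c := Module.finBasis k F
  have h : K ≤ Submodule.span k (Set.range fun p : Fin (Module.finrank k E) ×
      Fin (Module.finrank k F) => b p.1 ⊗ₜ[k] c p.2) := by
    have := (b.tensorProduct c).span_eq
    rw [show ⇑(b.tensorProduct c) = fun p => b p.1 ⊗ₜ[k] c p.2 by
      ext1 p; exact Module.Basis.tensorProduct_apply' b c p] at this
    rw [this]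
    exact le_top
  simpa using sRank_span_le _ _ h

theorem sRank_add_two_mul_finrank_le (u : Module.Basis (Fin 2) k F)
    {L K : Submodule k (E ⊗[k] F)} (hLK : L ≤ K) :
    sRank k K + 2 * Module.finrank k L ≤ sRank k L + 2 * Module.finrank k K := by
  obtain ⟨Q, hQ⟩ := L.exists_isCompl
  have hK : L ⊔ Q ⊓ K = K := by rw [← sup_inf_assoc_of_le Q hLK, hQ.sup_eq_top, top_inf_eq]
  have hdim := Submodule.finrank_sup_add_finrank_inf_eq L (Q ⊓ K)
  rw [hK, ← inf_assoc, hQ.inf_eq_bot, bot_inf_eq, finrank_bot] at hdim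
  have h₁ := sRank_sup_le L (Q ⊓ K)
  rw [hK] at h₁
  have h₂ := sRank_le_two_mul_finrank u (Q ⊓ K)
  omega

theorem sRank_span_pair_le_three (u₀ u₁ : F) (x y z : E) :
    sRank k (Submodule.span k
      (Set.range ![x ⊗ₜ[k] u₀ + y ⊗ₜ[k] u₁, y ⊗ₜ[k] u₀ + z ⊗ₜ[k] u₁])) ≤ 3 := by
  refine sRank_span_le ![x - y, y, z - y] ![u₀, u₀ + u₁, u₁] ?_
  have hmem : ∀ i, (![x - y, y, z - y] i) ⊗ₜ[k] (![u₀, u₀ + u₁, u₁] i) ∈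
      Submodule.span k (Set.range fun i : Fin 3 =>
        (![x - y, y, z - y] i) ⊗ₜ[k] (![u₀, u₀ + u₁, u₁] i)) :=
    fun i => Submodule.subset_span ⟨i, rfl⟩
  rw [Submodule.span_le]
  rintro _ ⟨i, rfl⟩
  fin_cases i
  · convert! add_mem (hmem 0) (hmem 1) using 1
    simp [TensorProduct.sub_tmul, TensorProduct.tmul_add]
    abel
  · convert! add_mem (hmem 1) (hmem 2) using 1
    simp [TensorProduct.sub_tmul, TensorProduct.tmul_add]

theorem sRank_lt_two_mul_finrank_of_finrank_eq (u : Module.Basis (Fin 2) k F)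
    {K : Submodule k (E ⊗[k] F)} (hK : Module.finrank k K = Module.finrank k E)
    (hE : 0 < Module.finrank k E) :
    sRank k K < 2 * Module.finrank k K := by
  have simple_case : ∀ w ∈ K, w ≠ 0 → (∃ b c, w = b ⊗ₜ[k] c) →
      sRank k K < 2 * Module.finrank k K := by
    rintro _ hw hw₀ ⟨b, c, rfl⟩
    have h₁ := sRank_add_two_mul_finrank_le u ((Submodule.span_singleton_le_iff_mem _ K).2 hw)
    rw [finrank_span_singleton hw₀] at h₁
    have h₂ : sRank k (Submodule.span k {b ⊗ₜ[k] c}) ≤ 1 := by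
      simpa using sRank_span_le (fun _ : Unit => b) (fun _ : Unit => c)
        (W := Submodule.span k {b ⊗ₜ[k] c}) (by simp)
    omega
  by_cases hinj : Function.Injective ((slice u 0).domRestrict K)
  · have hsurj := (LinearMap.injective_iff_surjective_of_finrank_eq_finrank hK).1 hinj
    have : Nontrivial K := Module.nontrivial_of_finrank_pos (R := k) (hK ▸ hE)
    obtain ⟨⟨w₁, hw₁⟩, hne⟩ := exists_ne (0 : K)
    replace hne : w₁ ≠ 0 := fun h => hne (Subtype.ext h)
    obtain ⟨⟨w₂, hw₂⟩, h₂₁⟩ := hsurj (slice u 1 w₁)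
    replace h₂₁ : slice u 0 w₂ = slice u 1 w₁ := h₂₁
    have e₁ := eq_slice_tmul_add_slice_tmul u w₁
    have e₂ := eq_slice_tmul_add_slice_tmul u w₂
    rw [h₂₁] at e₂
    by_cases hli : LinearIndependent k ![w₁, w₂]
    · have hL : Submodule.span k (Set.range ![w₁, w₂]) ≤ K := by
        rw [Submodule.span_le]
        rintro _ ⟨i, rfl⟩
        fin_cases i
        · exact hw₁
        · exact hw₂
      have h₁ := sRank_add_two_mul_finrank_le u hL
      rw [finrank_span_eq_card hli, Fintype.card_fin] at h₁
      have h₃ := sRank_span_pair_le_three (k := k) (u 0) (u 1) (slice u 0 w₁) (slice u 1 w₁)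
        (slice u 1 w₂)
      rw [← e₁, ← e₂] at h₃
      omega
    · rw [LinearIndependent.pair_iff' hne] at hli
      push Not at hli
      obtain ⟨a, rfl⟩ := hli
      refine simple_case w₁ hw₁ hne ⟨slice u 0 w₁, u 0 + a • u 1, ?_⟩
      rw [TensorProduct.tmul_add, ← TensorProduct.smul_tmul, ← map_smul, h₂₁]
      exact e₁
  · rw [← LinearMap.ker_eq_bot, LinearMap.ker_eq_bot'] at hinj
    push Not at hinj
    obtain ⟨⟨w, hw⟩, h₀, hne⟩ := hinj
    replace h₀ : slice u 0 w = 0 := h₀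
    refine simple_case w hw (fun h => hne (Subtype.ext h)) ⟨slice u 1 w, u 1, ?_⟩
    conv_lhs => rw [eq_slice_tmul_add_slice_tmul u w, h₀]
    simp

theorem sRank_le_finrank_add_finrank_sub_one (hF : Module.finrank k F ≤ 2)
    (K : Submodule k (E ⊗[k] F)) :
    sRank k K ≤ Module.finrank k K + (Module.finrank k E - 1) := by
  by_cases hE : Module.finrank k E ≤ 1
  · exact (sRank_le_finrank_of_forall_simple fun w _ =>
      exists_eq_tmul_of_finrank_left_le_one hE w).trans (Nat.le_add_right _ _)
  by_cases hF₁ : Module.finrank k F ≤ 1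
  · exact (sRank_le_finrank_of_forall_simple fun w _ =>
      exists_eq_tmul_of_finrank_right_le_one hF₁ w).trans (Nat.le_add_right _ _)
  have hF₂ : Module.finrank k F = 2 := by omega
  let u := Module.finBasisOfFinrankEq k F hF₂
  have h₁ := sRank_le_two_mul_finrank u K
  have h₂ := sRank_le_finrank_mul_finrank K
  rw [hF₂] at h₂
  have h₃ := sRank_lt_two_mul_finrank_of_finrank_eq u (K := K)
  omega

end Pencil

section Substitution

variable {k : Type*} [Field k] {B C D : Type*}
  [AddCommGroup B] [Module k B] [AddCommGroup C] [Module k C] [AddCommGroup D] [Module k D]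

/-- A linearly independent family is sent to any prescribed family by a linear map defined on the
whole space and with range spanned by the prescribed values. -/
theorem LinearIndependent.exists_linearMap_eq {ι : Type*} {v : ι → D}
    (hv : LinearIndependent k v) (w : ι → B) :
    ∃ ψ : D →ₗ[k] B, (∀ i, ψ (v i) = w i) ∧
      LinearMap.range ψ = Submodule.span k (Set.range w) := by
  obtain ⟨ret, hret⟩ := LinearMap.exists_leftInverse_of_injective
    (Submodule.span k (Set.range v)).subtype (Submodule.ker_subtype _)
  have hret' : ∀ x : Submodule.span k (Set.range v), ret (x : D) = x :=
    fun x => LinearMap.congr_fun hret x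
  have hψ : ∀ i, ((Finsupp.linearCombination k w ∘ₗ hv.repr) ∘ₗ ret) (v i) = w i := by
    intro i
    have h := hret' (⟨v i, Submodule.subset_span ⟨i, rfl⟩⟩ : Submodule.span k (Set.range v))
    simp only [LinearMap.comp_apply] at h ⊢
    rw [h, hv.repr_eq_single i _ rfl, Finsupp.linearCombination_single,
      one_smul]
  refine ⟨_, hψ, le_antisymm ?_ ?_⟩
  · rw [LinearMap.comp_assoc]
    exact (LinearMap.range_comp_le_range _ _).trans (Finsupp.range_linearCombination k).le
  · rw [Submodule.span_le]
    rintro _ ⟨i, rfl⟩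
    exact ⟨v i, hψ i⟩

theorem LinearIndependent.tmul_of_ne_zero {ι : Type*} {v : ι → B} (hv : LinearIndependent k v)
    {c : ι → C} (hc : ∀ i, c i ≠ 0) : LinearIndependent k fun i => v i ⊗ₜ[k] c i := by
  obtain ⟨ψ, hψ, -⟩ := hv.exists_linearMap_eq (fun i => Finsupp.single i (1 : k))
  rw [linearIndependent_iff']
  intro s a ha i hi
  have h := congr_arg (TensorProduct.lid k C ∘ TensorProduct.map (Finsupp.lapply i ∘ₗ ψ)
    LinearMap.id) ha
  classical
  simpa [hψ, Finsupp.single_apply, hi, hc i] using h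

variable [FiniteDimensional k B] [FiniteDimensional k C]

/-- The substitution method in the first factor. -/
theorem exists_substitution_left (S : Set (B × C)) (q : B →ₗ[k] D) :
    ∃ θ : B →ₗ[k] B, (∀ b, q b = 0 → θ b = b) ∧ (∀ p ∈ S, p.2 ≠ 0 → q (θ p.1) = 0) ∧
      Module.finrank k (LinearMap.range (LinearMap.id - θ)) ≤
        Module.finrank k (Submodule.span k ((fun p => q p.1) '' {p ∈ S | p.2 ≠ 0})) ∧
      Module.finrank k ((simpleSpan k S).map (TensorProduct.map θ LinearMap.id)) +
        Module.finrank k (Submodule.span k ((fun p => q p.1) '' {p ∈ S | p.2 ≠ 0})) ≤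
        Module.finrank k (simpleSpan k S) := by
  obtain ⟨J, hJ, -, hspan, hli⟩ := exists_linearIndepOn_extension
    (v := fun p : B × C => q p.1) (linearIndepOn_empty k _) (Set.empty_subset {p ∈ S | p.2 ≠ 0})
  have hG : Submodule.span k ((fun p => q p.1) '' {p ∈ S | p.2 ≠ 0}) =
      Submodule.span k (Set.range fun j : J => q j.1.1) := by
    rw [← Set.image_eq_range (fun p : B × C => q p.1) J]
    exact le_antisymm (Submodule.span_le.2 hspan) (Submodule.span_mono (Set.image_mono hJ))
  rw [LinearIndepOn] at hli
  obtain ⟨ψ, hψ, hrange⟩ := hli.exists_linearMap_eq (fun j : J => j.1.1)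
  have hliB : LinearIndependent k fun j : J => j.1.1 := LinearIndependent.of_comp q hli
  have : Finite J := hliB.finite
  have := Fintype.ofFinite J
  have hcard : Module.finrank k (Submodule.span k ((fun p => q p.1) '' {p ∈ S | p.2 ≠ 0})) =
      Fintype.card J := by rw [hG]; exact finrank_span_eq_card hli
  have hqψ : ∀ x ∈ Submodule.span k ((fun p => q p.1) '' {p ∈ S | p.2 ≠ 0}), q (ψ x) = x := by
    rw [hG]
    intro x hx
    induction hx using Submodule.span_induction with
    | mem x hx => obtain ⟨j, rfl⟩ := hx; rw [hψ j]
    | zero => simp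
    | add x y _ _ hx hy => rw [map_add, map_add, hx, hy]
    | smul a x _ hx => rw [map_smul, map_smul, hx]
  refine ⟨LinearMap.id - ψ ∘ₗ q, fun b hb => by simp [hb], fun p hp hp₂ => ?_, ?_, ?_⟩
  · simp [hqψ _ (Submodule.subset_span ⟨p, ⟨hp, hp₂⟩, rfl⟩)]
  · rw [sub_sub_cancel, hcard, ← finrank_span_eq_card hliB, ← hrange]
    exact Submodule.finrank_mono (LinearMap.range_comp_le_range _ _)
  · rw [← finrank_map_add_finrank_inf_ker
      (TensorProduct.map (LinearMap.id - ψ ∘ₗ q) (LinearMap.id : C →ₗ[k] C)) (simpleSpan k S)]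
    refine Nat.add_le_add_left ?_ _
    rw [hcard, ← finrank_span_eq_card
      (hliB.tmul_of_ne_zero (c := fun j : J => j.1.2) fun j => (hJ j.2).2)]
    refine Submodule.finrank_mono (Submodule.span_le.2 ?_)
    rintro _ ⟨j, rfl⟩
    refine ⟨tmul_mem_simpleSpan (hJ j.2).1, ?_⟩
    simp [hψ j]

/-- The substitution method in the second factor. -/
theorem exists_substitution_right (S : Set (B × C)) (q : C →ₗ[k] D) :
    ∃ θ : C →ₗ[k] C, (∀ c, q c = 0 → θ c = c) ∧ (∀ p ∈ S, p.1 ≠ 0 → q (θ p.2) = 0) ∧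
      Module.finrank k ((simpleSpan k S).map (TensorProduct.map LinearMap.id θ)) +
        Module.finrank k (LinearMap.range (LinearMap.id - θ)) ≤
        Module.finrank k (simpleSpan k S) := by
  obtain ⟨θ, h₁, h₂, h₃, h₄⟩ := exists_substitution_left (Prod.swap '' S) q
  refine ⟨θ, h₁, fun p hp hp₁ => h₂ p.swap ⟨p, hp, rfl⟩ hp₁, ?_⟩
  have hcomm : ∀ T : Set (B × C), simpleSpan k (Prod.swap '' T) =
      (simpleSpan k T).map (TensorProduct.comm k B C).toLinearMap := by
    intro T
    rw [simpleSpan, simpleSpan, Submodule.map_span, Set.image_image, Set.image_image]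
    rfl
  have hswap : Prod.map θ (LinearMap.id : B →ₗ[k] B) '' (Prod.swap '' S) =
      Prod.swap '' (Prod.map (LinearMap.id : B →ₗ[k] B) θ '' S) := by
    rw [Set.image_image, Set.image_image]; rfl
  rw [map_simpleSpan, hswap, hcomm, hcomm, LinearEquiv.finrank_map_eq,
    LinearEquiv.finrank_map_eq, ← map_simpleSpan] at h₄
  omega

end Substitution

section Modification

variable {k : Type*} [Field k] {B F : Type*}
  [AddCommGroup B] [Module k B] [FiniteDimensional k B]
  [AddCommGroup F] [Module k F] [FiniteDimensional k F]

theorem sRank_le_of_le_range_rTensor_subtype (hF : Module.finrank k F ≤ 2) (E : Submodule k B)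
    (K : Submodule k (B ⊗[k] F))
    (hK : K ≤ LinearMap.range (TensorProduct.map E.subtype (LinearMap.id : F →ₗ[k] F))) :
    sRank k K ≤ Module.finrank k K + (Module.finrank k E - 1) := by
  have hinj : Function.Injective (TensorProduct.map E.subtype (LinearMap.id : F →ₗ[k] F)) :=
    Module.Flat.rTensor_preserves_injective_linearMap E.subtype E.injective_subtype
  have hmap := Submodule.map_comap_eq_of_le hK
  have hfin := finrank_map_add_finrank_inf_ker
    (TensorProduct.map E.subtype (LinearMap.id : F →ₗ[k] F))
    (K.comap (TensorProduct.map E.subtype (LinearMap.id : F →ₗ[k] F)))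
  rw [hmap, LinearMap.ker_eq_bot.2 hinj, inf_bot_eq, finrank_bot, add_zero] at hfin
  have h := sRank_map_le E.subtype (LinearMap.id : F →ₗ[k] F)
    (K.comap (TensorProduct.map E.subtype (LinearMap.id : F →ₗ[k] F)))
  rw [hmap] at h
  have h' := sRank_le_finrank_add_finrank_sub_one hF
    (K.comap (TensorProduct.map E.subtype (LinearMap.id : F →ₗ[k] F)))
  omega

theorem exists_sRank_le_finrank_add (hF : Module.finrank k F ≤ 2) (E : Submodule k B)
    (Γ : Set (B × F)) (W : Submodule k (B ⊗[k] F))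
    (hW : W ≤ simpleSpan k Γ ⊔
      LinearMap.range (TensorProduct.map E.subtype (LinearMap.id : F →ₗ[k] F))) :
    ∃ M ≤ W ⊔ simpleSpan k Γ, sRank k W ≤ Module.finrank k M + (Module.finrank k E - 1) := by
  set T := TensorProduct.map E.mkQ (LinearMap.id : F →ₗ[k] F) with hT
  have hker : LinearMap.ker T =
      LinearMap.range (TensorProduct.map E.subtype (LinearMap.id : F →ₗ[k] F)) :=
    LinearMap.exact_iff.1 (rTensor_exact F (LinearMap.exact_subtype_mkQ E) E.mkQ_surjective)
  obtain ⟨J, hJ, -, hspan, hli⟩ := exists_linearIndepOn_extension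
    (v := fun p : B × F => T (p.1 ⊗ₜ[k] p.2)) (linearIndepOn_empty k _) (Set.empty_subset Γ)
  have hXJ : simpleSpan k J = Submodule.span k (Set.range fun j : J => j.1.1 ⊗ₜ[k] j.1.2) := by
    rw [simpleSpan, ← Set.image_eq_range (fun p : B × F => p.1 ⊗ₜ[k] p.2) J]
  have hTJ : (simpleSpan k J).map T =
      Submodule.span k ((fun p : B × F => T (p.1 ⊗ₜ[k] p.2)) '' J) := by
    rw [simpleSpan, Submodule.map_span, Set.image_image]
  have hfin : Module.finrank k ((simpleSpan k J).map T) = Module.finrank k (simpleSpan k J) := by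
    have hliT : LinearIndependent k fun j : J => T (j.1.1 ⊗ₜ[k] j.1.2) := hli
    have hliX : LinearIndependent k fun j : J => j.1.1 ⊗ₜ[k] j.1.2 := hliT.of_comp T
    have : Finite J := hliX.finite
    have := Fintype.ofFinite J
    rw [hTJ, hXJ, finrank_span_eq_card hliX, ← finrank_span_eq_card hliT,
      ← Set.image_eq_range (fun p : B × F => T (p.1 ⊗ₜ[k] p.2)) J]
  have hTΓ : (simpleSpan k Γ).map T ≤ (simpleSpan k J).map T := by
    rw [hTJ, Submodule.map_le_iff_le_comap, simpleSpan_le]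
    exact fun p hp => hspan ⟨p, hp, rfl⟩
  have hTW : W.map T ≤ (simpleSpan k J).map T := by
    refine (Submodule.map_mono hW).trans ?_
    rw [Submodule.map_sup, ← hker, (LinearMap.le_ker_iff_map).1 le_rfl, sup_bot_eq]
    exact hTΓ
  have hJΓ : simpleSpan k J ≤ simpleSpan k Γ := simpleSpan_le.2 fun p hp =>
    tmul_mem_simpleSpan (hJ hp)
  refine ⟨W ⊔ simpleSpan k J, sup_le_sup_left hJΓ _, ?_⟩
  set M := W ⊔ simpleSpan k J with hM
  have hMT : M.map T = (simpleSpan k J).map T := by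
    rw [hM, Submodule.map_sup, sup_eq_right.2 hTW]
  have hMle : M ≤ simpleSpan k J ⊔ (M ⊓ LinearMap.ker T) := by
    intro m hm
    obtain ⟨x, hx, hxm⟩ := hMT.le (Submodule.mem_map_of_mem hm)
    refine Submodule.mem_sup.2 ⟨x, hx, m - x, ⟨M.sub_mem hm (Submodule.mem_sup_right hx), ?_⟩,
      add_sub_cancel _ _⟩
    rw [SetLike.mem_coe, LinearMap.mem_ker, map_sub, hxm, sub_self]
  have h₁ := finrank_map_add_finrank_inf_ker T M
  rw [hMT, hfin] at h₁
  have h₂ := sRank_le_of_le_range_rTensor_subtype hF E (M ⊓ LinearMap.ker T)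
    (hker ▸ inf_le_right)
  have h₃ := sRank_mono ((le_sup_left : W ≤ M).trans hMle)
  have h₄ := sRank_sup_le (simpleSpan k J) (M ⊓ LinearMap.ker T)
  have h₅ := sRank_le_finrank_simpleSpan (le_refl (simpleSpan k J))
  omega

end Modification

section Core

variable {k : Type*} [Field k] {B' B'' F C'' : Type*}
  [AddCommGroup B'] [Module k B'] [FiniteDimensional k B']
  [AddCommGroup B''] [Module k B''] [FiniteDimensional k B'']
  [AddCommGroup F] [Module k F] [FiniteDimensional k F]
  [AddCommGroup C''] [Module k C''] [FiniteDimensional k C'']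

theorem finrank_le_finrank_map_mkQ_span_singleton_add_one (b : B') (E : Submodule k B') :
    Module.finrank k E ≤
      Module.finrank k (E.map (Submodule.span k {b}).mkQ) + 1 := by
  rw [← finrank_map_add_finrank_inf_ker (Submodule.span k {b}).mkQ E, Submodule.ker_mkQ]
  refine Nat.add_le_add_left ((Submodule.finrank_mono inf_le_right).trans ?_) _
  exact (finrank_span_le_card {b}).trans (by simp)

/-- A span of simple tensors containing `W''` and a space `N` of tensors `b₀ ⊗ y` has dimension at
least `R(W'') + dim N`, and more if the first factors have many components in `B'`. -/
theorem sRank_add_finrank_add_le_finrank_simpleSpan (b₀ : B') (S : Set ((B' × B'') × C''))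
    (W'' : Submodule k (B'' ⊗[k] C''))
    (hW'' : W''.map (TensorProduct.map (LinearMap.inr k B' B'') LinearMap.id) ≤ simpleSpan k S)
    (N : Submodule k ((B' × B'') ⊗[k] C'')) (hN : N ≤ simpleSpan k S)
    (hN₀ : ∀ n ∈ N, ∃ y : C'', n = (b₀, 0) ⊗ₜ[k] y) :
    sRank k W'' + Module.finrank k N + (Module.finrank k
      (Submodule.span k ((fun p => p.1.1) '' {p ∈ S | p.2 ≠ 0})) - 1) ≤
      Module.finrank k (simpleSpan k S) := by
  obtain ⟨θ, hθ, -, -, hfin⟩ := exists_substitution_left S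
    ((Submodule.span k {b₀}).mkQ ∘ₗ LinearMap.fst k B' B'')
  have hE := finrank_le_finrank_map_mkQ_span_singleton_add_one b₀
    (Submodule.span k ((fun p => p.1.1) '' {p ∈ S | p.2 ≠ 0}))
  rw [Submodule.map_span, Set.image_image] at hE
  have hθb : θ (b₀, 0) = (b₀, 0) := hθ _ (by simp)
  have hθr : θ ∘ₗ LinearMap.inr k B' B'' = LinearMap.inr k B' B'' :=
    LinearMap.ext fun b => hθ _ (by simp)
  set P := (simpleSpan k S).map (TensorProduct.map θ (LinearMap.id : C'' →ₗ[k] C'')) with hP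
  have hQ : W'' ≤ P.map (TensorProduct.map (LinearMap.snd k B' B'') LinearMap.id) := by
    intro w hw
    refine ⟨_, ⟨_, hW'' ⟨w, hw, rfl⟩, rfl⟩, ?_⟩
    rw [← LinearMap.comp_apply, ← LinearMap.comp_apply, ← TensorProduct.map_comp,
      ← TensorProduct.map_comp, LinearMap.comp_assoc, hθr]
    simp
  have hr : sRank k W'' ≤ Module.finrank k
      (P.map (TensorProduct.map (LinearMap.snd k B' B'') (LinearMap.id : C'' →ₗ[k] C''))) := by
    rw [hP, map_simpleSpan, map_simpleSpan] at hQ ⊢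
    exact sRank_le_finrank_simpleSpan hQ
  have hNP : N ≤ P ⊓ LinearMap.ker
      (TensorProduct.map (LinearMap.snd k B' B'') (LinearMap.id : C'' →ₗ[k] C'')) := by
    intro n hn
    have hnS := hN hn
    obtain ⟨y, rfl⟩ := hN₀ n hn
    exact ⟨⟨_, hnS, by simp [hθb]⟩, by simp⟩
  have h₁ := finrank_map_add_finrank_inf_ker
    (TensorProduct.map (LinearMap.snd k B' B'') (LinearMap.id : C'' →ₗ[k] C'')) P
  have h₂ := Submodule.finrank_mono hNP
  have h₃ := (Nat.add_le_add_left (Nat.sub_le_of_le_add hE) (Module.finrank k P)).trans hfin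
  omega

theorem sRank_add_sRank_le_finrank_simpleSpan (hF : Module.finrank k F ≤ 2) (b₀ : B')
    (S : Set ((B' × B'') × (F × C''))) (W' : Submodule k (B' ⊗[k] F))
    (W'' : Submodule k (B'' ⊗[k] C''))
    (hW' : ∀ w ∈ W', ∃ y : C'',
      ιL k B' B'' F C'' w + (b₀, 0) ⊗ₜ[k] (0, y) ∈ simpleSpan k S)
    (hW'' : W''.map (ιR k B' B'' F C'') ≤ simpleSpan k S) :
    sRank k W' + sRank k W'' ≤ Module.finrank k (simpleSpan k S) := by
  set π := TensorProduct.map (LinearMap.id : (B' × B'') →ₗ[k] _) (LinearMap.snd k F C'') with hπ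
  set σ := TensorProduct.map (LinearMap.fst k B' B'') (LinearMap.fst k F C'') with hσ
  have hσL : ∀ w, σ (ιL k B' B'' F C'' w) = w := fun w => by
    rw [ιL, hσ, ← LinearMap.comp_apply, ← TensorProduct.map_comp]; simp
  have hπL : ∀ w, π (ιL k B' B'' F C'' w) = 0 := fun w => by
    rw [ιL, hπ, ← LinearMap.comp_apply, ← TensorProduct.map_comp]; simp
  have hπR : π ∘ₗ ιR k B' B'' F C'' =
      TensorProduct.map (LinearMap.inr k B' B'') LinearMap.id := by
    rw [ιR, hπ, ← TensorProduct.map_comp]; simp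
  set E := Submodule.span k ((fun p : (B' × B'') × (F × C'') => p.1.1) '' {p ∈ S | p.2.2 ≠ 0})
    with hE
  set Γ := (fun p : (B' × B'') × (F × C'') => (p.1.1, p.2.1)) '' {p ∈ S | p.2.2 = 0} with hΓ
  have hWΓ : W' ≤ simpleSpan k Γ ⊔
      LinearMap.range (TensorProduct.map E.subtype (LinearMap.id : F →ₗ[k] F)) := by
    have hσS : (simpleSpan k S).map σ ≤ simpleSpan k Γ ⊔
        LinearMap.range (TensorProduct.map E.subtype (LinearMap.id : F →ₗ[k] F)) := by
      rw [Submodule.map_le_iff_le_comap, simpleSpan_le]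
      intro p hp
      rw [Submodule.mem_comap, hσ, TensorProduct.map_tmul]
      by_cases h0 : p.2.2 = 0
      · exact Submodule.mem_sup_left (tmul_mem_simpleSpan (k := k) (p := (p.1.1, p.2.1))
          ⟨p, ⟨hp, h0⟩, rfl⟩)
      · exact Submodule.mem_sup_right ⟨(⟨p.1.1, Submodule.subset_span ⟨p, ⟨hp, h0⟩, rfl⟩⟩ : E)
          ⊗ₜ[k] p.2.1, rfl⟩
    intro w hw
    obtain ⟨y, hy⟩ := hW' w hw
    exact hσS ⟨_, hy, by rw [map_add, hσL, hσ]; simp⟩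
  obtain ⟨M, hM, hrM⟩ := exists_sRank_le_finrank_add hF E Γ W' hWΓ
  set N := simpleSpan k S ⊓
    (LinearMap.range (TensorProduct.mk k (B' × B'') C'' (b₀, 0))).comap π with hN
  have hMN : M ≤ N.map σ := by
    refine hM.trans (sup_le ?_ (simpleSpan_le.2 ?_))
    · intro w hw
      obtain ⟨y, hy⟩ := hW' w hw
      refine ⟨_, ⟨hy, y, ?_⟩, by rw [map_add, hσL, hσ]; simp⟩
      rw [map_add, hπL, hπ]
      simp
    · rintro _ ⟨p, ⟨hp, h0⟩, rfl⟩
      refine ⟨_, ⟨tmul_mem_simpleSpan hp, 0, ?_⟩, by rw [hσ]; rfl⟩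
      rw [hπ]
      simp [h0]
  have hP : (simpleSpan k S).map π = simpleSpan k (Prod.map id Prod.snd '' S) :=
    map_simpleSpan LinearMap.id (LinearMap.snd k F C'') S
  have h₀ := sRank_add_finrank_add_le_finrank_simpleSpan b₀ (Prod.map id Prod.snd '' S) W''
    (by rw [← hP, ← hπR, Submodule.map_comp]; exact Submodule.map_mono hW'') (N.map π)
    (by rw [← hP]; exact Submodule.map_mono inf_le_left)
    (by rintro _ ⟨n, ⟨-, y, hy⟩, rfl⟩; exact ⟨y, hy.symm⟩)
  have hE' : E ≤ Submodule.span k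
      ((fun p => p.1.1) '' {p ∈ Prod.map id Prod.snd '' S | p.2 ≠ 0}) := by
    refine Submodule.span_mono ?_
    rintro _ ⟨p, ⟨hp, h0⟩, rfl⟩
    exact ⟨(p.1, p.2.2), ⟨⟨p, hp, rfl⟩, h0⟩, rfl⟩
  rw [← hP] at h₀
  have h₁ := finrank_map_add_finrank_inf_ker π (simpleSpan k S)
  have h₂ := finrank_map_add_finrank_inf_ker π N
  have h₃ : Module.finrank k (N ⊓ LinearMap.ker π : Submodule k _) ≤
      Module.finrank k (simpleSpan k S ⊓ LinearMap.ker π : Submodule k _) :=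
    Submodule.finrank_mono (inf_le_inf_right _ inf_le_left)
  have h₄ := Submodule.finrank_mono hE'
  have h₅ := (Submodule.finrank_mono hMN).trans (Submodule.finrank_map_le σ N)
  omega

end Core

section Hook

variable {k : Type*} [Field k] {B' B'' C' C'' : Type*}
  [AddCommGroup B'] [Module k B'] [AddCommGroup B''] [Module k B'']
  [AddCommGroup C'] [Module k C'] [AddCommGroup C''] [Module k C'']

theorem map_id_sub (f g : C' →ₗ[k] C'') :
    TensorProduct.map (LinearMap.id : B' →ₗ[k] B') (f - g) =
      TensorProduct.map LinearMap.id f - TensorProduct.map LinearMap.id g :=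
  LinearMap.lTensor_sub f g

theorem exists_map_eq_tmul_of_hook {X : Type*} [AddCommGroup X] [Module k X] {b₀ : B'}
    {F : Submodule k C'} {E : Submodule k B'} (hE : ∀ b ∈ E, ∃ a : k, a • b₀ = b)
    {g : C' →ₗ[k] X} (hg : ∀ c ∈ F, g c = 0) {w : B' ⊗[k] C'}
    (hw : w ∈ tensorSub k E (⊤ : Submodule k C') ⊔ tensorSub k (⊤ : Submodule k B') F) :
    ∃ x : X, TensorProduct.map LinearMap.id g w = b₀ ⊗ₜ[k] x := by
  have h : tensorSub k E (⊤ : Submodule k C') ⊔ tensorSub k (⊤ : Submodule k B') F ≤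
      (LinearMap.range (TensorProduct.mk k B' X b₀)).comap
        (TensorProduct.map LinearMap.id g) := by
    refine sup_le (Submodule.span_le.2 ?_) (Submodule.span_le.2 ?_)
    · rintro _ ⟨b, hb, c, -, rfl⟩
      obtain ⟨a, rfl⟩ := hE b hb
      exact ⟨a • g c, by simp [TensorProduct.smul_tmul]⟩
    · rintro _ ⟨b, -, c, hc, rfl⟩
      exact ⟨0, by simp [hg c hc]⟩
  obtain ⟨x, hx⟩ := h hw
  exact ⟨x, hx.symm⟩

variable [FiniteDimensional k B'] [FiniteDimensional k B'']
  [FiniteDimensional k C'] [FiniteDimensional k C'']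

theorem sRank_add_sRank_le_of_one_two_hook (W' : Submodule k (B' ⊗[k] C'))
    (W'' : Submodule k (B'' ⊗[k] C'')) (b₀ : B') (E : Submodule k B') (F : Submodule k C')
    (hE : ∀ b ∈ E, ∃ a : k, a • b₀ = b) (hF : Module.finrank k F ≤ 2)
    (hW' : W' ≤ tensorSub k E (⊤ : Submodule k C') ⊔ tensorSub k (⊤ : Submodule k B') F) :
    sRank k W' + sRank k W'' ≤
      sRank k (W'.map (ιL k B' B'' C' C'') ⊔ W''.map (ιR k B' B'' C' C'')) := by
  obtain ⟨S, hS, hr⟩ := exists_simpleSpan_finrank_le_sRank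
    (W'.map (ιL k B' B'' C' C'') ⊔ W''.map (ιR k B' B'' C' C''))
  obtain ⟨π, hπ⟩ := LinearMap.exists_leftInverse_of_injective F.subtype F.ker_subtype
  have hπF : ∀ c ∈ F, (π c : C') = c := fun c hc =>
    congr_arg Subtype.val (LinearMap.congr_fun hπ (⟨c, hc⟩ : F))
  obtain ⟨θ, hθ, hθS, hfin⟩ := exists_substitution_right S
    ((LinearMap.id - F.subtype ∘ₗ π) ∘ₗ LinearMap.fst k C' C'')
  set q := (LinearMap.id - F.subtype ∘ₗ π) ∘ₗ LinearMap.fst k C' C'' with hq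
  set τ := LinearMap.fst k C' C'' ∘ₗ θ ∘ₗ LinearMap.inl k C' C'' with hτ
  set ρ := LinearMap.snd k C' C'' ∘ₗ θ ∘ₗ LinearMap.inl k C' C'' with hρ
  set Θ := LinearMap.prodMap π (LinearMap.id : C'' →ₗ[k] C'') ∘ₗ θ with hΘ
  have hθF : ∀ c ∈ F, θ (c, 0) = (c, 0) := fun c hc => hθ _ (by simp [hq, hπF c hc])
  have hΘL : Θ ∘ₗ LinearMap.inl k C' C'' =
      LinearMap.inl k F C'' ∘ₗ (π ∘ₗ τ) + LinearMap.inr k F C'' ∘ₗ ρ := by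
    ext c <;> simp [hΘ, hτ, hρ]
  have hΘR : Θ ∘ₗ LinearMap.inr k C' C'' = LinearMap.inr k F C'' := by
    refine LinearMap.ext fun c => ?_
    have : θ (0, c) = (0, c) := hθ _ (by simp [hq])
    simp [hΘ, this]
  set W₁ := W'.map (TensorProduct.map (LinearMap.id : B' →ₗ[k] B') (π ∘ₗ τ)) with hW₁
  have hcore := sRank_add_sRank_le_finrank_simpleSpan hF b₀
    (Prod.map (LinearMap.id : (B' × B'') →ₗ[k] _) Θ '' S) W₁ W'' (by
      rintro _ ⟨w, hw, rfl⟩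
      obtain ⟨y, hy⟩ := exists_map_eq_tmul_of_hook hE (g := ρ)
        (fun c hc => by simp [hρ, hθF c hc]) (hW' hw)
      refine ⟨y, ?_⟩
      rw [← map_simpleSpan]
      refine ⟨ιL k B' B'' C' C'' w, hS (Submodule.mem_sup_left ⟨w, hw, rfl⟩), ?_⟩
      have hy' : (TensorProduct.map (LinearMap.inl k B' B'') (LinearMap.inr k F C''))
          (TensorProduct.map LinearMap.id ρ w) = (b₀, 0) ⊗ₜ[k] (0, y) := by rw [hy]; rfl
      rw [← hy', ιL, ιL, ← LinearMap.comp_apply, ← LinearMap.comp_apply, ← LinearMap.comp_apply,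
        ← TensorProduct.map_comp, ← TensorProduct.map_comp, ← TensorProduct.map_comp, hΘL,
        TensorProduct.map_add_right]
      rfl) (by
      rw [← map_simpleSpan]
      rintro _ ⟨w, hw, rfl⟩
      refine ⟨ιR k B' B'' C' C'' w, hS (Submodule.mem_sup_right ⟨w, hw, rfl⟩), ?_⟩
      rw [ιR, ιR, ← LinearMap.comp_apply, ← TensorProduct.map_comp, hΘR]
      rfl)
  have hVq : simpleSpan k S ≤
      LinearMap.ker (TensorProduct.map (LinearMap.fst k B' B'') (q ∘ₗ θ)) := by
    refine simpleSpan_le.2 fun p hp => ?_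
    by_cases h0 : p.1 = 0
    · simp [h0]
    · simp [hθS p hp h0]
  have hqτ : (q ∘ₗ θ) ∘ₗ LinearMap.inl k C' C'' = τ - F.subtype ∘ₗ (π ∘ₗ τ) := by
    ext c; simp [hq, hτ]
  have hWτ : ∀ w ∈ W', TensorProduct.map (LinearMap.id : B' →ₗ[k] B') τ w =
      TensorProduct.map LinearMap.id F.subtype (TensorProduct.map LinearMap.id (π ∘ₗ τ) w) := by
    intro w hw
    have h : TensorProduct.map (LinearMap.fst k B' B'') (q ∘ₗ θ) (ιL k B' B'' C' C'' w) = 0 :=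
      hVq (hS (Submodule.mem_sup_left ⟨w, hw, rfl⟩))
    rw [ιL, ← LinearMap.comp_apply, ← TensorProduct.map_comp, hqτ, LinearMap.fst_comp_inl,
      map_id_sub, LinearMap.sub_apply, sub_eq_zero] at h
    rw [h, ← LinearMap.comp_apply, ← TensorProduct.map_comp, LinearMap.id_comp]
  set R := LinearMap.range (LinearMap.id - τ) with hR
  have hWle : W' ≤ W₁.map (TensorProduct.map LinearMap.id F.subtype) ⊔
      R.map (TensorProduct.mk k B' C' b₀) := by
    intro w hw
    obtain ⟨x, hx⟩ := exists_map_eq_tmul_of_hook hE (g := (LinearMap.id - τ).rangeRestrict)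
      (fun c hc => Subtype.ext (by simp [hτ, hθF c hc])) (hW' hw)
    have hx' : TensorProduct.map (LinearMap.id : B' →ₗ[k] B') (LinearMap.id - τ) w =
        b₀ ⊗ₜ[k] (x : C') := by
      have h := congr_arg (TensorProduct.map (LinearMap.id : B' →ₗ[k] B') R.subtype) hx
      rwa [← LinearMap.comp_apply, ← TensorProduct.map_comp, LinearMap.id_comp,
        LinearMap.subtype_comp_codRestrict] at h
    rw [map_id_sub, LinearMap.sub_apply, TensorProduct.map_id,
      LinearMap.id_apply, hWτ w hw] at hx'
    exact Submodule.mem_sup.2 ⟨_, ⟨_, ⟨w, hw, rfl⟩, rfl⟩, _, ⟨x, x.2, rfl⟩, by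
      rw [TensorProduct.mk_apply, ← hx', add_sub_cancel]⟩
  have hRg : Module.finrank k R ≤ Module.finrank k (LinearMap.range (LinearMap.id - θ)) := by
    have : R ≤ (LinearMap.range (LinearMap.id - θ)).map (LinearMap.fst k C' C'') := by
      rintro _ ⟨c, rfl⟩
      exact ⟨_, ⟨(c, 0), rfl⟩, by simp [hτ]⟩
    exact (Submodule.finrank_mono this).trans (Submodule.finrank_map_le _ _)
  have h₁ := (sRank_mono hWle).trans (sRank_sup_le _ _)
  have h₂ := sRank_map_le (LinearMap.id : B' →ₗ[k] B') F.subtype W₁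
  have h₃ : sRank k (R.map (TensorProduct.mk k B' C' b₀)) ≤ _ :=
    sRank_le_finrank_of_forall_simple (by rintro _ ⟨x, -, rfl⟩; exact ⟨b₀, x, rfl⟩)
  have h₄ := Submodule.finrank_map_le (TensorProduct.mk k B' C' b₀) R
  have h₅ : Module.finrank k ((simpleSpan k S).map (TensorProduct.map LinearMap.id Θ)) ≤
      Module.finrank k ((simpleSpan k S).map (TensorProduct.map LinearMap.id θ)) := by
    rw [hΘ, ← LinearMap.id_comp (LinearMap.id : (B' × B'') →ₗ[k] _), TensorProduct.map_comp,
      Submodule.map_comp, LinearMap.id_comp]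
    exact Submodule.finrank_map_le _ _
  rw [← map_simpleSpan] at hcore
  omega

end Hook

/-- Over any field, if `W'` is `(1,2)`-hook shaped then additivity of rank holds:
`R(W' ⊕ W'') = R(W') + R(W'')`. -/
theorem additivity_of_one_two_hook {k : Type*} [Field k] {B' B'' C' C'' : Type*}
    [AddCommGroup B'] [Module k B'] [FiniteDimensional k B']
    [AddCommGroup B''] [Module k B''] [FiniteDimensional k B'']
    [AddCommGroup C'] [Module k C'] [FiniteDimensional k C']
    [AddCommGroup C''] [Module k C''] [FiniteDimensional k C'']
    (W' : Submodule k (B' ⊗[k] C')) (W'' : Submodule k (B'' ⊗[k] C''))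
    (hhook : ∃ (E : Submodule k B') (F : Submodule k C'),
      Module.finrank k E ≤ 1 ∧ Module.finrank k F ≤ 2 ∧
      W' ≤ tensorSub k E (⊤ : Submodule k C') ⊔ tensorSub k (⊤ : Submodule k B') F) :
    sRank k (W'.map (ιL k B' B'' C' C'') ⊔ W''.map (ιR k B' B'' C' C'')) =
      sRank k W' + sRank k W'' := by
  obtain ⟨E, F, hE, hF, hW'⟩ := hhook
  obtain ⟨b₀, hb₀⟩ := finrank_le_one_iff.1 hE
  refine le_antisymm ((sRank_sup_le _ _).trans
    (Nat.add_le_add (sRank_map_le _ _ _) (sRank_map_le _ _ _)))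
    (sRank_add_sRank_le_of_one_two_hook W' W'' b₀ E F (fun b hb => ?_) hF hW')
  obtain ⟨a, ha⟩ := hb₀ ⟨b, hb⟩
  exact ⟨a, congr_arg Subtype.val ha⟩
end

section
/- Over any field k (JaJa–Takche): if one of the six vector spaces A', A'', B', B'', C', C'' has dimension at most 2, then for p' ∈ A'⊗B'⊗C' and p'' ∈ A''⊗B''⊗C'' one has R(p'⊕p'') = R(p') + R(p''). -/
open TensorProduct

/-- Tensor rank of `p ∈ A ⊗ B ⊗ C`: minimal number of simple tensors summing to `p`. -/
noncomputable def tRank (k : Type*) [Field k] {A B C : Type*} [AddCommGroup A] [Module k A]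
    [AddCommGroup B] [Module k B] [AddCommGroup C] [Module k C]
    (p : A ⊗[k] (B ⊗[k] C)) : ℕ :=
  sInf {r | ∃ a : Fin r → A, ∃ b : Fin r → B, ∃ c : Fin r → C,
    p = ∑ i, a i ⊗ₜ[k] (b i ⊗ₜ[k] c i)}

/-- The direct sum tensor `p' ⊕ p''`. -/
noncomputable def dsTensor {k : Type*} [Field k] {A' A'' B' B'' C' C'' : Type*}
    [AddCommGroup A'] [Module k A'] [AddCommGroup A''] [Module k A'']
    [AddCommGroup B'] [Module k B'] [AddCommGroup B''] [Module k B'']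
    [AddCommGroup C'] [Module k C'] [AddCommGroup C''] [Module k C'']
    (p' : A' ⊗[k] (B' ⊗[k] C')) (p'' : A'' ⊗[k] (B'' ⊗[k] C'')) :
    (A' × A'') ⊗[k] ((B' × B'') ⊗[k] (C' × C'')) :=
  TensorProduct.map (LinearMap.inl k A' A'')
    (TensorProduct.map (LinearMap.inl k B' B'') (LinearMap.inl k C' C'')) p'
  + TensorProduct.map (LinearMap.inr k A' A'')
    (TensorProduct.map (LinearMap.inr k B' B'') (LinearMap.inr k C' C'')) p''

open Module in
/-- **Rado's theorem**, defect version for linear matroids: if every subfamily `T` of a family of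
finite sets of vectors spans a space of dimension at least `#T - d`, then all but at most `d` of
the sets have a linearly independent system of representatives. -/
theorem exists_linearIndepOn_transversal {k V ι : Type*} [Field k] [AddCommGroup V] [Module k V]
    [FiniteDimensional k V] [Fintype ι] (X : ι → Finset V) (d : ℕ)
    (h : ∀ T : Finset ι,
      T.card ≤ finrank k (T.sup fun i => Submodule.span k (X i : Set V) : Submodule k V) + d) :
    ∃ (J : Finset ι) (x : ι → V), (∀ i ∈ J, x i ∈ X i) ∧ LinearIndepOn k x (J : Set ι) ∧
      Fintype.card ι ≤ J.card + d := by
  classical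
  induction hn : ∑ i, (X i).card using Nat.strong_induction_on generalizing X with
  | _ n ih =>
  by_cases hX : ∀ i, (X i).card ≤ 1
  · let x : ι → V := fun i => if hi : (X i).Nonempty then hi.choose else 0
    have hx : ∀ i, (X i).Nonempty → x i ∈ X i := fun i hi => by
      simp only [x, dif_pos hi]
      exact hi.choose_spec
    obtain ⟨b, hbK, -, hspan, hb⟩ := exists_linearIndepOn_extension
      (linearIndepOn_empty k x) (Set.empty_subset {i | (X i).Nonempty})
    refine ⟨b.toFinset, x, fun i hi => hx i (hbK (Set.mem_toFinset.1 hi)), by simpa using hb, ?_⟩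
    refine (h Finset.univ).trans (Nat.add_le_add_right ?_ d)
    have hle : (Finset.univ.sup fun i => Submodule.span k (X i : Set V)) ≤
        Submodule.span k ((b.toFinset.image x : Finset V) : Set V) := by
      refine Finset.sup_le fun i _ => Submodule.span_le.2 fun v hv => ?_
      have hi : (X i).Nonempty := ⟨v, hv⟩
      rw [Finset.card_le_one.1 (hX i) v hv (x i) (hx i hi)]
      simpa using hspan ⟨i, hi, rfl⟩
    exact (Submodule.finrank_mono hle).trans
      ((finrank_span_finset_le_card _).trans Finset.card_image_le)
  · push Not at hX
    obtain ⟨i, hi⟩ := hX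
    obtain ⟨v, hv, w, hw, hvw⟩ := Finset.one_lt_card.1 hi
    by_cases hred : ∃ u ∈ X i, ∀ T : Finset ι, T.card ≤ finrank k
        (T.sup fun j => Submodule.span k (Function.update X i ((X i).erase u) j : Set V) :
          Submodule k V) + d
    · obtain ⟨u, hu, hT⟩ := hred
      obtain ⟨J, x, hxJ, hli, hcard⟩ := ih _ (by
        rw [← hn]
        refine Finset.sum_lt_sum (fun j _ => ?_) ⟨i, Finset.mem_univ i, ?_⟩
        · rcases eq_or_ne j i with rfl | hj
          · simpa using Finset.card_le_card (Finset.erase_subset _ _)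
          · simp [hj]
        · simpa using Finset.card_erase_lt_of_mem hu) _ hT rfl
      refine ⟨J, x, fun j hj => ?_, hli, hcard⟩
      have := hxJ j hj
      rcases eq_or_ne j i with rfl | hji
      · exact Finset.mem_of_mem_erase (by simpa using this)
      · simpa [hji] using this
    · exfalso
      push Not at hred
      have key : ∀ u ∈ X i, ∃ T : Finset ι, i ∉ T ∧
          finrank k (Submodule.span k ((X i).erase u : Set V) ⊔
            T.sup fun j => Submodule.span k (X j : Set V) : Submodule k V) + d ≤ T.card := by
        intro u hu
        obtain ⟨T, hT⟩ := hred u hu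
        have hrest : ∀ S : Finset ι, i ∉ S →
            (S.sup fun j => Submodule.span k
              (Function.update X i ((X i).erase u) j : Set V)) =
            S.sup fun j => Submodule.span k (X j : Set V) := fun S hS =>
          Finset.sup_congr rfl fun j hj => by
            rw [Function.update_of_ne (ne_of_mem_of_not_mem hj hS)]
        have hiT : i ∈ T := by
          by_contra hiT
          rw [hrest T hiT] at hT
          exact absurd (h T) (not_le.2 hT)
        refine ⟨T.erase i, Finset.notMem_erase i T, ?_⟩
        rw [← Finset.insert_erase hiT, Finset.sup_insert, hrest _ (Finset.notMem_erase i T),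
          Finset.card_insert_of_notMem (Finset.notMem_erase i T), Function.update_self] at hT
        exact Nat.lt_succ_iff.1 hT
      obtain ⟨S, hiS, hS⟩ := key v hv
      obtain ⟨T, hiT, hT⟩ := key w hw
      set f : ι → Submodule k V := fun j => Submodule.span k (X j : Set V) with hf
      set P := Submodule.span k ((X i).erase v : Set V) ⊔ S.sup f
      set Q := Submodule.span k ((X i).erase w : Set V) ⊔ T.sup f
      have hunion : (insert i (S ∪ T)).sup f ≤ P ⊔ Q := by
        rw [Finset.sup_insert, Finset.sup_union]
        refine sup_le (Submodule.span_le.2 fun z hz => ?_)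
          (sup_le_sup le_sup_right le_sup_right)
        rcases eq_or_ne z v with rfl | hzv
        · exact le_sup_right (a := P) (le_sup_left (b := T.sup f)
            (Submodule.subset_span (Finset.mem_erase.2 ⟨hvw, hz⟩)))
        · exact le_sup_left (b := Q) (le_sup_left (b := S.sup f)
            (Submodule.subset_span (Finset.mem_erase.2 ⟨hzv, hz⟩)))
      have hinter : (S ∩ T).sup f ≤ P ⊓ Q := le_inf
        ((Finset.sup_mono Finset.inter_subset_left).trans le_sup_right)
        ((Finset.sup_mono Finset.inter_subset_right).trans le_sup_right)
      have h1 := (h (insert i (S ∪ T))).trans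
        (Nat.add_le_add_right (Submodule.finrank_mono hunion) d)
      have h2 := (h (S ∩ T)).trans (Nat.add_le_add_right (Submodule.finrank_mono hinter) d)
      have h3 := Submodule.finrank_sup_add_finrank_inf_eq P Q
      have h4 := Finset.card_union_add_card_inter S T
      rw [Finset.card_insert_of_notMem (by simp [hiS, hiT])] at h1
      omega

/-- A linear map may be prescribed arbitrarily on linearly independent vectors. -/
theorem LinearIndepOn.exists_linearMap {k V W ι : Type*} [Field k] [AddCommGroup V] [Module k V]
    [AddCommGroup W] [Module k W] {v : ι → V} {s : Set ι} (hv : LinearIndepOn k v s)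
    (w : ι → W) : ∃ f : V →ₗ[k] W, ∀ i ∈ s, f (v i) = w i := by
  obtain ⟨f, hf⟩ := LinearMap.exists_extend
    ((Module.Basis.span hv.linearIndependent).constr k fun i : s => w i)
  refine ⟨f, fun i hi => ?_⟩
  have h := LinearMap.congr_fun hf (Module.Basis.span hv.linearIndependent ⟨i, hi⟩)
  rwa [Module.Basis.constr_basis, LinearMap.comp_apply, Submodule.subtype_apply,
    Module.Basis.span_apply] at h

section TensorRank

variable {k : Type*} [Field k] {A B C : Type*} [AddCommGroup A] [Module k A]
  [AddCommGroup B] [Module k B] [AddCommGroup C] [Module k C]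

theorem tRank_sum_le {ι : Type*} (s : Finset ι) (a : ι → A) (b : ι → B) (c : ι → C) :
    tRank k (∑ i ∈ s, a i ⊗ₜ[k] (b i ⊗ₜ[k] c i)) ≤ s.card := by
  refine Nat.sInf_le ⟨fun j => a (s.equivFin.symm j), fun j => b (s.equivFin.symm j),
    fun j => c (s.equivFin.symm j), ?_⟩
  rw [← Finset.sum_coe_sort s]
  exact (s.equivFin.symm.sum_comp
    fun i : s => a i ⊗ₜ[k] (b i ⊗ₜ[k] c i)).symm

theorem exists_eq_sum_tmul (p : A ⊗[k] (B ⊗[k] C)) :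
    ∃ (r : ℕ) (a : Fin r → A) (b : Fin r → B) (c : Fin r → C),
      p = ∑ i, a i ⊗ₜ[k] (b i ⊗ₜ[k] c i) := by
  have hadd : ∀ p q : A ⊗[k] (B ⊗[k] C),
      (∃ (r : ℕ) (a : Fin r → A) (b : Fin r → B) (c : Fin r → C),
        p = ∑ i, a i ⊗ₜ[k] (b i ⊗ₜ[k] c i)) →
      (∃ (r : ℕ) (a : Fin r → A) (b : Fin r → B) (c : Fin r → C),
        q = ∑ i, a i ⊗ₜ[k] (b i ⊗ₜ[k] c i)) →
      ∃ (r : ℕ) (a : Fin r → A) (b : Fin r → B) (c : Fin r → C),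
        p + q = ∑ i, a i ⊗ₜ[k] (b i ⊗ₜ[k] c i) := by
    rintro _ _ ⟨r, a, b, c, rfl⟩ ⟨s, a', b', c', rfl⟩
    exact ⟨r + s, Fin.append a a', Fin.append b b', Fin.append c c', by simp [Fin.sum_univ_add]⟩
  induction p using TensorProduct.induction_on with
  | zero => exact ⟨0, 0, 0, 0, by simp⟩
  | add p q hp hq => exact hadd p q hp hq
  | tmul a q =>
    induction q using TensorProduct.induction_on with
    | zero => exact ⟨0, 0, 0, 0, by simp⟩
    | tmul b c => exact ⟨1, fun _ => a, fun _ => b, fun _ => c, by simp⟩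
    | add p q hp hq => simpa [TensorProduct.tmul_add] using hadd _ _ hp hq

theorem exists_eq_sum_tmul_tRank (p : A ⊗[k] (B ⊗[k] C)) :
    ∃ (a : Fin (tRank k p) → A) (b : Fin (tRank k p) → B) (c : Fin (tRank k p) → C),
      p = ∑ i, a i ⊗ₜ[k] (b i ⊗ₜ[k] c i) :=
  Nat.sInf_mem (s := {r | ∃ a : Fin r → A, ∃ b : Fin r → B, ∃ c : Fin r → C,
    p = ∑ i, a i ⊗ₜ[k] (b i ⊗ₜ[k] c i)}) (exists_eq_sum_tmul p)

theorem tRank_add_le (p q : A ⊗[k] (B ⊗[k] C)) : tRank k (p + q) ≤ tRank k p + tRank k q := by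
  obtain ⟨a, b, c, h⟩ := exists_eq_sum_tmul_tRank p
  obtain ⟨a', b', c', h'⟩ := exists_eq_sum_tmul_tRank q
  exact Nat.sInf_le ⟨Fin.append a a', Fin.append b b', Fin.append c c', by
    simp [Fin.sum_univ_add, ← h, ← h']⟩

/-- A linear map sending simple tensors to simple tensors does not increase the rank. -/
theorem tRank_map_le {A₁ B₁ C₁ : Type*} [AddCommGroup A₁] [Module k A₁]
    [AddCommGroup B₁] [Module k B₁] [AddCommGroup C₁] [Module k C₁]
    (f : A ⊗[k] (B ⊗[k] C) →ₗ[k] A₁ ⊗[k] (B₁ ⊗[k] C₁))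
    (hf : ∀ a b c, ∃ a₁ b₁ c₁, f (a ⊗ₜ (b ⊗ₜ c)) = a₁ ⊗ₜ (b₁ ⊗ₜ c₁))
    (p : A ⊗[k] (B ⊗[k] C)) : tRank k (f p) ≤ tRank k p := by
  obtain ⟨a, b, c, h⟩ := exists_eq_sum_tmul_tRank p
  choose a₁ b₁ c₁ h₁ using hf
  refine Nat.sInf_le ⟨fun i => a₁ (a i) (b i) (c i), fun i => b₁ (a i) (b i) (c i),
    fun i => c₁ (a i) (b i) (c i), ?_⟩
  conv_lhs => rw [h]
  simp only [map_sum, h₁]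

open Module in
theorem tRank_sum_le_finrank_mul_finrank_span [FiniteDimensional k A] {ι : Type*} (s : Finset ι)
    (a : ι → A) (b : ι → B) (c : ι → C) :
    tRank k (∑ i ∈ s, a i ⊗ₜ[k] (b i ⊗ₜ[k] c i)) ≤
      finrank k A * finrank k (Submodule.span k (b '' s)) := by
  have : FiniteDimensional k (Submodule.span k (b '' s)) :=
    FiniteDimensional.span_of_finite k (s.finite_toSet.image b)
  let u := finBasis k A
  let f := finBasis k (Submodule.span k (b '' s))
  have hb : ∀ i, ∃ β : Fin (finrank k (Submodule.span k (b '' s))) → k,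
      i ∈ s → b i = ∑ j, β j • (f j : B) := by
    intro i
    by_cases hi : i ∈ s
    · have hmem : b i ∈ Submodule.span k (b '' s) := Submodule.subset_span ⟨i, hi, rfl⟩
      refine ⟨f.repr ⟨b i, hmem⟩, fun _ => ?_⟩
      have := congrArg (Submodule.subtype _) (f.sum_repr ⟨b i, hmem⟩)
      rw [map_sum] at this
      exact this.symm
    · exact ⟨0, fun h => absurd h hi⟩
  choose β hβ using hb
  have hsum : ∑ i ∈ s, a i ⊗ₜ[k] (b i ⊗ₜ[k] c i) =
      ∑ x : Fin (finrank k A) × Fin (finrank k (Submodule.span k (b '' s))),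
        u x.1 ⊗ₜ[k] ((f x.2 : B) ⊗ₜ[k] ∑ i ∈ s, (u.repr (a i) x.1 * β i x.2) • c i) := by
    simp only [TensorProduct.tmul_sum]
    rw [Finset.sum_comm]
    refine Finset.sum_congr rfl fun i hi => ?_
    conv_lhs => rw [← u.sum_repr (a i), hβ i hi]
    simp only [TensorProduct.sum_tmul, TensorProduct.tmul_sum, Fintype.sum_prod_type]
    rw [Finset.sum_comm]
    simp only [← TensorProduct.smul_tmul', TensorProduct.tmul_smul, smul_smul, mul_comm]
  rw [hsum]
  simpa using tRank_sum_le Finset.univ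
    (fun x : Fin (finrank k A) × Fin (finrank k (Submodule.span k (b '' s))) => u x.1)
    (fun x => (f x.2 : B)) (fun x => ∑ i ∈ s, (u.repr (a i) x.1 * β i x.2) • c i)

theorem tRank_lTensor_comm_le (p : A ⊗[k] (B ⊗[k] C)) :
    tRank k ((TensorProduct.comm k B C).toLinearMap.lTensor A p) ≤ tRank k p :=
  tRank_map_le _ (fun a b c => ⟨a, c, b, by simp⟩) p

theorem tRank_le_lTensor_comm (p : A ⊗[k] (B ⊗[k] C)) :
    tRank k p ≤ tRank k ((TensorProduct.comm k B C).toLinearMap.lTensor A p) := by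
  have h := tRank_lTensor_comm_le ((TensorProduct.comm k B C).toLinearMap.lTensor A p)
  rwa [← LinearMap.comp_apply, ← LinearMap.lTensor_comp, TensorProduct.comm_comp_comm,
    LinearMap.lTensor_id, LinearMap.id_apply] at h

theorem tRank_leftComm_le (p : A ⊗[k] (B ⊗[k] C)) :
    tRank k (TensorProduct.leftComm k A B C p) ≤ tRank k p :=
  tRank_map_le (TensorProduct.leftComm k A B C).toLinearMap (fun a b c => ⟨b, a, c, by simp⟩) p

theorem tRank_le_leftComm (p : A ⊗[k] (B ⊗[k] C)) :
    tRank k p ≤ tRank k (TensorProduct.leftComm k A B C p) := by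
  have h := tRank_map_le (TensorProduct.leftComm k A B C).symm.toLinearMap
    (fun b a c => ⟨a, b, c, by simp⟩) (TensorProduct.leftComm k A B C p)
  simpa using h

open Module in
/-- The rank of a sum of simple tensors in `A ⊗ B ⊗ C` with `dim A ≤ 2` is at most the sum of the
dimensions of the spaces spanned by the second and third components. -/
theorem tRank_sum_le_finrank_span_add [FiniteDimensional k A] (hA : finrank k A ≤ 2) {ι : Type*}
    (s : Finset ι) (a : ι → A) (b : ι → B) (c : ι → C) :
    tRank k (∑ i ∈ s, a i ⊗ₜ[k] (b i ⊗ₜ[k] c i)) ≤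
      finrank k (Submodule.span k (b '' s)) + finrank k (Submodule.span k (c '' s)) := by
  have h1 := tRank_sum_le_finrank_mul_finrank_span (k := k) s a b c
  have h2 := (tRank_le_lTensor_comm (∑ i ∈ s, a i ⊗ₜ[k] (b i ⊗ₜ[k] c i))).trans
    (by simpa using tRank_sum_le_finrank_mul_finrank_span (k := k) s a c b)
  have h3 := Nat.mul_le_mul_right (finrank k (Submodule.span k (b '' s))) hA
  have h4 := Nat.mul_le_mul_right (finrank k (Submodule.span k (c '' s))) hA
  omega

end TensorRank

open Module in
theorem finrank_span_add_finrank_span_le {k B C ι : Type*} [Field k]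
    [AddCommGroup B] [Module k B] [FiniteDimensional k B]
    [AddCommGroup C] [Module k C] [FiniteDimensional k C] (s : Finset ι) (b : ι → B) (c : ι → C)
    (P : Submodule k (B × C)) (hb : ∀ i ∈ s, (b i, 0) ∈ P) (hc : ∀ i ∈ s, (0, c i) ∈ P) :
    finrank k (Submodule.span k (b '' s)) + finrank k (Submodule.span k (c '' s)) ≤
      finrank k P := by
  rw [← finrank_prod]
  refine LinearMap.finrank_le_finrank_of_injective
    (f := (((Submodule.span k (b '' s)).subtype.prodMap
      (Submodule.span k (c '' s)).subtype).codRestrict P ?_)) ?_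
  · rintro ⟨⟨x, hx⟩, ⟨y, hy⟩⟩
    have hx' : x ∈ P.comap (LinearMap.inl k B C) :=
      Submodule.span_le.2 (by rintro _ ⟨i, hi, rfl⟩; exact hb i hi) hx
    have hy' : y ∈ P.comap (LinearMap.inr k B C) :=
      Submodule.span_le.2 (by rintro _ ⟨i, hi, rfl⟩; exact hc i hi) hy
    simpa using P.add_mem hx' hy'
  · intro x y hxy
    have := congrArg Subtype.val hxy
    simpa [Prod.ext_iff] using this

section DirectSum

variable {k : Type*} [Field k] {A' A'' B' B'' C' C'' : Type*}
  [AddCommGroup A'] [Module k A'] [AddCommGroup A''] [Module k A'']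
  [AddCommGroup B'] [Module k B'] [AddCommGroup B''] [Module k B'']
  [AddCommGroup C'] [Module k C'] [AddCommGroup C''] [Module k C'']
  (p' : A' ⊗[k] (B' ⊗[k] C')) (p'' : A'' ⊗[k] (B'' ⊗[k] C''))

theorem tRank_dsTensor_le : tRank k (dsTensor p' p'') ≤ tRank k p' + tRank k p'' :=
  (tRank_add_le _ _).trans (add_le_add
    (tRank_map_le _ (fun a b c => ⟨_, _, _, by simp only [TensorProduct.map_tmul]; rfl⟩) p')
    (tRank_map_le _ (fun a b c => ⟨_, _, _, by simp only [TensorProduct.map_tmul]; rfl⟩) p''))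

theorem map_snd_dsTensor :
    TensorProduct.map (LinearMap.snd k A' A'')
      (TensorProduct.map (LinearMap.snd k B' B'') (LinearMap.snd k C' C''))
      (dsTensor p' p'') = p'' := by
  simp [dsTensor, ← LinearMap.comp_apply, ← TensorProduct.map_comp]

theorem map_fst_dsTensor (f : B'' →ₗ[k] B') (g : C'' →ₗ[k] C') :
    TensorProduct.map (LinearMap.fst k A' A'')
      (TensorProduct.map (LinearMap.id.coprod f) (LinearMap.id.coprod g))
      (dsTensor p' p'') = p' := by
  simp [dsTensor, ← LinearMap.comp_apply, ← TensorProduct.map_comp]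

open Module in
theorem tRank_add_tRank_le_of_dsTensor_eq_sum [FiniteDimensional k A'']
    [FiniteDimensional k B''] [FiniteDimensional k C''] (hA : finrank k A'' ≤ 2) {r : ℕ}
    (a : Fin r → A' × A'') (b : Fin r → B' × B'') (c : Fin r → C' × C'')
    (h : dsTensor p' p'' = ∑ i, a i ⊗ₜ[k] (b i ⊗ₜ[k] c i)) :
    tRank k p' + tRank k p'' ≤ r := by
  classical
  let Z : Finset (Fin r) := Finset.univ.filter fun i => (a i).1 = 0
  have hp'' : p'' = ∑ i, (a i).2 ⊗ₜ[k] ((b i).2 ⊗ₜ[k] (c i).2) := by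
    conv_lhs => rw [← map_snd_dsTensor p' p'', h]
    simp
  have hbound : ∀ S : Finset (Fin r), tRank k p'' + S.card ≤
      r + (finrank k (Submodule.span k ((fun i => (b i).2) '' S)) +
        finrank k (Submodule.span k ((fun i => (c i).2) '' S))) := by
    intro S
    have h1 := tRank_sum_le_finrank_span_add hA S (fun i => (a i).2) (fun i => (b i).2)
      (fun i => (c i).2)
    have h2 := tRank_sum_le (k := k) Sᶜ (fun i => (a i).2) (fun i => (b i).2) (fun i => (c i).2)
    have h3 := tRank_add_le (∑ i ∈ S, (a i).2 ⊗ₜ[k] ((b i).2 ⊗ₜ[k] (c i).2))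
      (∑ i ∈ Sᶜ, (a i).2 ⊗ₜ[k] ((b i).2 ⊗ₜ[k] (c i).2))
    rw [Finset.sum_add_sum_compl, ← hp''] at h3
    have h4 := Finset.card_add_card_compl S
    rw [Fintype.card_fin] at h4
    omega
  let X : Fin r → Finset (B'' × C'') := fun i =>
    if (a i).1 = 0 then ∅ else {((b i).2, 0), (0, (c i).2)}
  obtain ⟨J, x, hxJ, hli, hcard⟩ := exists_linearIndepOn_transversal (k := k) X
    (r + Z.card - tRank k p'') (by
      intro T
      have h1 := hbound (T \ Z)
      have h2 := finrank_span_add_finrank_span_le (k := k) (T \ Z) (fun i => (b i).2)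
        (fun i => (c i).2) (T.sup fun i => Submodule.span k (X i : Set (B'' × C'')))
        (fun i hi => by
          have hi := Finset.mem_sdiff.1 hi
          have hz : ¬ (a i).1 = 0 := by simpa [Z] using hi.2
          exact Finset.le_sup (f := fun i => Submodule.span k (X i : Set (B'' × C''))) hi.1
            (Submodule.subset_span (by simp [X, hz])))
        (fun i hi => by
          have hi := Finset.mem_sdiff.1 hi
          have hz : ¬ (a i).1 = 0 := by simpa [Z] using hi.2
          exact Finset.le_sup (f := fun i => Submodule.span k (X i : Set (B'' × C''))) hi.1
            (Submodule.subset_span (by simp [X, hz])))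
      have h3 : T.card ≤ (T \ Z).card + Z.card := by
        have := Finset.le_card_sdiff Z T
        omega
      omega)
  have hJZ : ∀ i ∈ J, ¬ (a i).1 = 0 := fun i hi h0 => by
    have := hxJ i hi
    simp [X, h0] at this
  have hxJ' : ∀ i ∈ J, x i = ((b i).2, 0) ∨ x i = (0, (c i).2) := fun i hi => by
    have := hxJ i hi
    simpa [X, hJZ i hi] using this
  have hliB : LinearIndepOn k (fun i => (b i).2) {i | i ∈ J ∧ x i = ((b i).2, 0)} :=
    LinearIndepOn.of_comp (LinearMap.inl k B'' C'')
      ((hli.mono fun i hi => hi.1).congr fun i hi => hi.2)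
  have hliC : LinearIndepOn k (fun i => (c i).2) {i | i ∈ J ∧ x i = (0, (c i).2)} :=
    LinearIndepOn.of_comp (LinearMap.inr k B'' C'')
      ((hli.mono fun i hi => hi.1).congr fun i hi => hi.2)
  obtain ⟨f, hf⟩ := hliB.exists_linearMap fun i => -(b i).1
  obtain ⟨g, hg⟩ := hliC.exists_linearMap fun i => -(c i).1
  have hp' : p' = ∑ i ∈ (Z ∪ J)ᶜ,
      (a i).1 ⊗ₜ[k] (((b i).1 + f (b i).2) ⊗ₜ[k] ((c i).1 + g (c i).2)) := by
    have hall : p' = ∑ i,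
        (a i).1 ⊗ₜ[k] (((b i).1 + f (b i).2) ⊗ₜ[k] ((c i).1 + g (c i).2)) := by
      conv_lhs => rw [← map_fst_dsTensor p' p'' f g, h]
      simp
    refine hall.trans (Finset.sum_subset (Finset.subset_univ _) fun i _ hi => ?_).symm
    rw [Finset.mem_compl, not_not, Finset.mem_union] at hi
    rcases hi with hi | hi
    · have hz : (a i).1 = 0 := by simpa [Z] using hi
      simp [hz]
    · rcases hxJ' i hi with hx | hx
      · simp [hf i ⟨hi, hx⟩]
      · simp [hg i ⟨hi, hx⟩]
  have h1 := tRank_sum_le (k := k) (Z ∪ J)ᶜ (fun i => (a i).1) (fun i => (b i).1 + f (b i).2)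
    (fun i => (c i).1 + g (c i).2)
  rw [← hp'] at h1
  have h2 := Finset.card_add_card_compl (Z ∪ J)
  have h3 : (Z ∪ J).card = Z.card + J.card := Finset.card_union_of_disjoint
    (Finset.disjoint_left.2 fun i hZ hJ => hJZ i hJ (by simpa [Z] using hZ))
  have h4 := tRank_sum_le (k := k) Finset.univ (fun i => (a i).2) (fun i => (b i).2)
    (fun i => (c i).2)
  rw [← hp'', Finset.card_fin] at h4
  rw [Fintype.card_fin] at h2 hcard
  omega

open Module in
theorem tRank_add_tRank_le_of_finrank_snd_le_two [FiniteDimensional k A'']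
    [FiniteDimensional k B''] [FiniteDimensional k C''] (hA : finrank k A'' ≤ 2) :
    tRank k p' + tRank k p'' ≤ tRank k (dsTensor p' p'') := by
  obtain ⟨a, b, c, h⟩ := exists_eq_sum_tmul_tRank (dsTensor p' p'')
  exact tRank_add_tRank_le_of_dsTensor_eq_sum p' p'' hA a b c h

theorem tRank_dsTensor_swap_le : tRank k (dsTensor p'' p') ≤ tRank k (dsTensor p' p'') := by
  have h := tRank_map_le
    (TensorProduct.map ((LinearMap.inr k A'' A').coprod (LinearMap.inl k A'' A'))
      (TensorProduct.map ((LinearMap.inr k B'' B').coprod (LinearMap.inl k B'' B'))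
        ((LinearMap.inr k C'' C').coprod (LinearMap.inl k C'' C'))))
    (fun a b c => ⟨_, _, _, by simp only [TensorProduct.map_tmul]; rfl⟩) (dsTensor p' p'')
  convert h using 2
  simp [dsTensor, ← LinearMap.comp_apply, ← TensorProduct.map_comp, add_comm]

theorem leftComm_dsTensor :
    TensorProduct.leftComm k (A' × A'') (B' × B'') (C' × C'') (dsTensor p' p'') =
      dsTensor (TensorProduct.leftComm k A' B' C' p')
        (TensorProduct.leftComm k A'' B'' C'' p'') := by
  simp only [dsTensor, map_add]
  congr 1
  · induction p' using TensorProduct.induction_on with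
    | zero => simp
    | add p q hp hq => simp only [map_add, hp, hq]
    | tmul a q =>
      induction q using TensorProduct.induction_on with
      | zero => simp
      | tmul b c => simp
      | add p q hp hq => simp only [TensorProduct.tmul_add, map_add, hp, hq]
  · induction p'' using TensorProduct.induction_on with
    | zero => simp
    | add p q hp hq => simp only [map_add, hp, hq]
    | tmul a q =>
      induction q using TensorProduct.induction_on with
      | zero => simp
      | tmul b c => simp
      | add p q hp hq => simp only [TensorProduct.tmul_add, map_add, hp, hq]

theorem lTensor_comm_dsTensor :
    (TensorProduct.comm k (B' × B'') (C' × C'')).toLinearMap.lTensor (A' × A'')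
        (dsTensor p' p'') =
      dsTensor ((TensorProduct.comm k B' C').toLinearMap.lTensor A' p')
        ((TensorProduct.comm k B'' C'').toLinearMap.lTensor A'' p'') := by
  simp only [dsTensor, map_add, LinearMap.lTensor, ← LinearMap.comp_apply,
    ← TensorProduct.map_comp, TensorProduct.map_comp_comm_eq, LinearMap.comp_id,
    LinearMap.id_comp]

open Module in
theorem tRank_add_tRank_le_of_finrank_fst_or_snd_le_two
    [FiniteDimensional k A'] [FiniteDimensional k A''] [FiniteDimensional k B']
    [FiniteDimensional k B''] [FiniteDimensional k C'] [FiniteDimensional k C'']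
    (hA : finrank k A' ≤ 2 ∨ finrank k A'' ≤ 2) :
    tRank k p' + tRank k p'' ≤ tRank k (dsTensor p' p'') := by
  rcases hA with hA | hA
  · rw [add_comm]
    exact (tRank_add_tRank_le_of_finrank_snd_le_two p'' p' hA).trans
      (tRank_dsTensor_swap_le p' p'')
  · exact tRank_add_tRank_le_of_finrank_snd_le_two p' p'' hA

open Module in
theorem tRank_add_tRank_le_of_finrank_middle_le_two
    [FiniteDimensional k A'] [FiniteDimensional k A''] [FiniteDimensional k B']
    [FiniteDimensional k B''] [FiniteDimensional k C'] [FiniteDimensional k C'']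
    (hB : finrank k B' ≤ 2 ∨ finrank k B'' ≤ 2) :
    tRank k p' + tRank k p'' ≤ tRank k (dsTensor p' p'') :=
  calc tRank k p' + tRank k p''
      ≤ tRank k (TensorProduct.leftComm k A' B' C' p') +
          tRank k (TensorProduct.leftComm k A'' B'' C'' p'') :=
        add_le_add (tRank_le_leftComm p') (tRank_le_leftComm p'')
    _ ≤ _ := tRank_add_tRank_le_of_finrank_fst_or_snd_le_two _ _ hB
    _ = _ := by rw [← leftComm_dsTensor]
    _ ≤ _ := tRank_leftComm_le _

open Module in
theorem tRank_add_tRank_le_of_finrank_last_le_two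
    [FiniteDimensional k A'] [FiniteDimensional k A''] [FiniteDimensional k B']
    [FiniteDimensional k B''] [FiniteDimensional k C'] [FiniteDimensional k C'']
    (hC : finrank k C' ≤ 2 ∨ finrank k C'' ≤ 2) :
    tRank k p' + tRank k p'' ≤ tRank k (dsTensor p' p'') :=
  calc tRank k p' + tRank k p''
      ≤ tRank k ((TensorProduct.comm k B' C').toLinearMap.lTensor A' p') +
          tRank k ((TensorProduct.comm k B'' C'').toLinearMap.lTensor A'' p'') :=
        add_le_add (tRank_le_lTensor_comm p') (tRank_le_lTensor_comm p'')
    _ ≤ _ := tRank_add_tRank_le_of_finrank_middle_le_two _ _ hC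
    _ = _ := by rw [← lTensor_comm_dsTensor]
    _ ≤ _ := tRank_lTensor_comm_le _

end DirectSum

/-- JaJa–Takche: over any field, if one of the six vector spaces has dimension at most 2,
then the rank of the direct sum tensor is additive. -/
theorem tRank_additive_of_small_factor {k : Type*} [Field k] {A' A'' B' B'' C' C'' : Type*}
    [AddCommGroup A'] [Module k A'] [FiniteDimensional k A']
    [AddCommGroup A''] [Module k A''] [FiniteDimensional k A'']
    [AddCommGroup B'] [Module k B'] [FiniteDimensional k B']
    [AddCommGroup B''] [Module k B''] [FiniteDimensional k B'']
    [AddCommGroup C'] [Module k C'] [FiniteDimensional k C']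
    [AddCommGroup C''] [Module k C''] [FiniteDimensional k C'']
    (p' : A' ⊗[k] (B' ⊗[k] C')) (p'' : A'' ⊗[k] (B'' ⊗[k] C''))
    (hsmall : Module.finrank k A' ≤ 2 ∨ Module.finrank k A'' ≤ 2 ∨
      Module.finrank k B' ≤ 2 ∨ Module.finrank k B'' ≤ 2 ∨
      Module.finrank k C' ≤ 2 ∨ Module.finrank k C'' ≤ 2) :
    tRank k (dsTensor p' p'') = tRank k p' + tRank k p'' := by
  refine le_antisymm (tRank_dsTensor_le p' p'') ?_
  rcases hsmall with h | h | h | h | h | h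
  · exact tRank_add_tRank_le_of_finrank_fst_or_snd_le_two p' p'' (Or.inl h)
  · exact tRank_add_tRank_le_of_finrank_fst_or_snd_le_two p' p'' (Or.inr h)
  · exact tRank_add_tRank_le_of_finrank_middle_le_two p' p'' (Or.inl h)
  · exact tRank_add_tRank_le_of_finrank_middle_le_two p' p'' (Or.inr h)
  · exact tRank_add_tRank_le_of_finrank_last_le_two p' p'' (Or.inl h)
  · exact tRank_add_tRank_le_of_finrank_last_le_two p' p'' (Or.inr h)
end
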